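/- arXiv:2507.05793 — 3 statements merged into one kernel-verified Lean document; each statement's English description precedes it below -/
import Mathlib

section
/- Every potential h on a recurrent rooted network satisfies |h(x)−h(y)| ≤ 1/c_{xy} for every edge {x,y}∈E. -/
open scoped Classical
open Filter Topology MeasureTheory ProbabilityTheory

/-- A weighted network: an infinite, connected, locally finite graph with
positive edge conductances, encoded by a symmetric conductance function. -/
structure Network (V : Type*) where
  c : V → V → ℝ
  symm : ∀ x y, c x y = c y x
  nonneg : ∀ x y, 0 ≤ c x y
  locFin : ∀ x, {y | 0 < c x y}.Finite
  conn : ∀ x y, Relation.ReflTransGen (fun a b => 0 < c a b) x y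
  deg_pos : ∀ x, 0 < ∑' y, c x y
  infinite : Infinite V

namespace Network

variable {V : Type*} (N : Network V)

/-- Total conductance at a vertex. -/
noncomputable def cTot (x : V) : ℝ := ∑' y, N.c x y

/-- One-step transition probabilities of the network random walk. -/
noncomputable def p (x y : V) : ℝ := N.c x y / N.cTot x

/-- `n`-step transition probabilities of the network random walk. -/
noncomputable def pstep : ℕ → V → V → ℝ
  | 0, x, y => if x = y then 1 else 0
  | n + 1, x, y => ∑' z, pstep n x z * N.p z y

/-- The network random walk is recurrent: the expected number of returns is infinite. -/
def Recurrent : Prop := ∀ x : V, ¬ Summable (fun n => N.pstep n x x)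

/-- `avoid A n x y` is the probability that the walk started at `x` is at `y` at time `n`
without having visited the set `A` at any time `0,…,n`, i.e. `P_x(X_n = y, τ_A > n)`. -/
noncomputable def avoid (A : Set V) : ℕ → V → V → ℝ
  | 0, x, y => if x = y ∧ x ∉ A then 1 else 0
  | n + 1, x, y => if y ∈ A then 0 else ∑' z, avoid A n x z * N.p z y

/-- Green kernel of the walk killed at `o`:  `G_o(x,y) = Σ_n P_x(X_n = y, τ_o > n)`. -/
noncomputable def GreenK (o x y : V) : ℝ := ∑' n, N.avoid {o} n x y

/-- Green density of the walk killed at `o`:  `g_o(x,y) = G_o(x,y)/c_y`. -/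
noncomputable def g (o x y : V) : ℝ := N.GreenK o x y / N.cTot y

/-- The network Laplacian `Δf(v) = Σ_x c_{vx}(f(x) − f(v))`. -/
noncomputable def lap (f : V → ℝ) (v : V) : ℝ := ∑' x, N.c v x * (f x - f v)

/-- A potential on the rooted network `(G,c,o)`: a nonnegative function vanishing at `o`,
with Laplacian `1` at `o` and harmonic elsewhere. -/
def IsPotential (o : V) (h : V → ℝ) : Prop :=
  (∀ v, 0 ≤ h v) ∧ h o = 0 ∧ N.lap h o = 1 ∧ ∀ v, v ≠ o → N.lap h v = 0

/-- Harmonic measure from `v` on a set `A`:  `ω_v^A(z) = P_v(X_{τ_A} = z)`. -/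
noncomputable def harm (A : Set V) (v z : V) : ℝ :=
  if v ∈ A then (if v = z then 1 else 0)
  else if z ∈ A then ∑' n, ∑' w, N.avoid A n v w * N.p w z
  else 0

/-- Effective resistance `R_eff(x ↔ y) = g_x(y,y)`. -/
noncomputable def Reff (x y : V) : ℝ := N.g x y y

/-- Transition probabilities of the Doob `h`-transform: `p^h(x,y) = p(x,y) h(y)/h(x)`. -/
noncomputable def ph (h : V → ℝ) (x y : V) : ℝ := N.p x y * h y / h x

/-- `n`-step transition probabilities of the `h`-process. -/
noncomputable def phstep (h : V → ℝ) : ℕ → V → V → ℝ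
  | 0, x, y => if x = y then 1 else 0
  | n + 1, x, y => ∑' z, phstep h n x z * N.ph h z y

/-- The initial distribution `μ_h(v) = c_{ov} h(v)`. -/
noncomputable def muh (o : V) (h : V → ℝ) (v : V) : ℝ := N.c o v * h v

end Network

/-- `P` is the law of the Markov chain with initial distribution `μ` and transition
probabilities `q`, as a measure on trajectory space. -/
def IsChainLaw {S : Type*} [MeasurableSpace S] (μ : S → ℝ) (q : S → S → ℝ)
    (P : MeasureTheory.Measure (ℕ → S)) : Prop :=
  ∀ (n : ℕ) (v : ℕ → S),
    P {ω | ∀ i ≤ n, ω i = v i} =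
      ENNReal.ofReal (μ (v 0) * ∏ i ∈ Finset.range n, q (v i) (v (i + 1)))

namespace Network

variable {V : Type*} (N : Network V)

lemma c_zero_of_not {x y : V} (hy : ¬ 0 < N.c x y) : N.c x y = 0 :=
  le_antisymm (not_lt.mp hy) (N.nonneg x y)

lemma summ (x : V) (f : V → ℝ) : Summable (fun y => N.c x y * f y) := by
  apply summable_of_ne_finset_zero (s := (N.locFin x).toFinset)
  intro y hy
  have : ¬ 0 < N.c x y := by simpa using hy
  rw [N.c_zero_of_not this, zero_mul]

lemma summ1 (x : V) : Summable (fun y => N.c x y) := by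
  simpa using N.summ x (fun _ => 1)

lemma cTot_pos (x : V) : 0 < N.cTot x := N.deg_pos x

lemma lap_eq (f : V → ℝ) (v : V) :
    N.lap f v = (∑' z, N.c v z * f z) - N.cTot v * f v := by
  unfold lap cTot
  rw [← tsum_mul_right, ← (N.summ v f).tsum_sub ((N.summ1 v).mul_right (f v))]
  exact tsum_congr fun z => by ring

/-- Normalised `n`-step probabilities. -/
noncomputable def aa (o : V) (n : ℕ) (v : V) : ℝ := N.pstep n o v / N.cTot v

lemma aa_zero (o v : V) : N.aa o 0 v = if o = v then 1 / N.cTot v else 0 := by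
  unfold aa pstep
  split_ifs <;> simp

lemma pstep_eq (o : V) (n : ℕ) (v : V) : N.pstep n o v = N.cTot v * N.aa o n v := by
  unfold aa
  have := (N.cTot_pos v).ne'
  field_simp

lemma aa_succ (o : V) (n : ℕ) (v : V) :
    N.cTot v * N.aa o (n + 1) v = ∑' z, N.c v z * N.aa o n z := by
  rw [← pstep_eq]
  unfold pstep
  refine tsum_congr fun z => ?_
  rw [pstep_eq, p, N.symm z v]
  have := (N.cTot_pos z).ne'
  field_simp

lemma aa_nonneg (o : V) (n : ℕ) (v : V) : 0 ≤ N.aa o n v := by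
  induction n generalizing v with
  | zero =>
    rw [aa_zero]
    have := N.cTot_pos v
    split_ifs <;> positivity
  | succ n ih =>
    have h1 : 0 ≤ N.cTot v * N.aa o (n + 1) v := by
      rw [aa_succ]
      exact tsum_nonneg fun z => mul_nonneg (N.nonneg _ _) (ih z)
    exact nonneg_of_mul_nonneg_right h1 (N.cTot_pos v)

lemma aa_fin (o : V) (n : ℕ) : ∃ S : Finset V, ∀ v, v ∉ S → N.aa o n v = 0 := by
  induction n with
  | zero =>
    refine ⟨{o}, fun v hv => ?_⟩
    rw [aa_zero, if_neg]
    rintro rfl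
    simp at hv
  | succ n ih =>
    obtain ⟨S, hS⟩ := ih
    refine ⟨S.biUnion fun z => (N.locFin z).toFinset, fun v hv => ?_⟩
    have h1 : N.cTot v * N.aa o (n + 1) v = 0 := by
      rw [aa_succ]
      rw [← tsum_zero (α := ℝ) (β := V)]
      refine tsum_congr fun z => ?_
      by_cases hz : z ∈ S
      · have : ¬ 0 < N.c z v := by
          intro hc
          apply hv
          simp only [Finset.mem_biUnion]
          exact ⟨z, hz, by simpa using hc⟩
        rw [N.symm v z, N.c_zero_of_not this, zero_mul]
      · rw [hS z hz, mul_zero]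
    exact (mul_eq_zero.mp h1).resolve_left (N.cTot_pos v).ne'

/-- Partial Green sums. -/
noncomputable def AA (o : V) (n : ℕ) (v : V) : ℝ := ∑ j ∈ Finset.range n, N.aa o j v

lemma sum_AA (o : V) (n : ℕ) (v : V) :
    ∑' z, N.c v z * N.AA o n z = N.cTot v * (N.AA o (n + 1) v - N.aa o 0 v) := by
  have h1 : N.AA o (n + 1) v - N.aa o 0 v = ∑ j ∈ Finset.range n, N.aa o (j + 1) v := by
    unfold AA
    rw [Finset.sum_range_succ']
    ring
  rw [h1, Finset.mul_sum]
  simp_rw [aa_succ, AA, Finset.mul_sum]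
  exact Summable.tsum_finsetSum fun j _ => N.summ v _

lemma AA_succ (o : V) (n : ℕ) (v : V) : N.AA o (n + 1) v = N.AA o n v + N.aa o n v :=
  Finset.sum_range_succ _ _

lemma AA_le (o : V) (n : ℕ) (v : V) : N.AA o n v ≤ N.AA o n o := by
  induction n generalizing v with
  | zero => simp [AA]
  | succ n ih =>
    by_cases hv : o = v
    · rw [hv]
    have h1 := N.sum_AA o n v
    rw [aa_zero, if_neg hv, sub_zero] at h1
    have h2 : ∑' z, N.c v z * N.AA o n z ≤ N.cTot v * N.AA o n o := by
      unfold cTot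
      rw [← tsum_mul_right]
      exact (N.summ v _).tsum_le_tsum
        (fun z => mul_le_mul_of_nonneg_left (ih z) (N.nonneg _ _)) ((N.summ1 v).mul_right _)
    rw [h1] at h2
    have h3 := le_of_mul_le_mul_left h2 (N.cTot_pos v)
    have h4 := N.AA_succ o n o
    have h5 := N.aa_nonneg o n o
    linarith

lemma D_step (o : V) (n : ℕ) (v z : V) :
    N.c v z * (N.AA o n o - N.AA o n z) ≤ N.cTot v * (N.AA o n o - N.AA o n v) + 1 := by
  have hs : ∑' z, N.c v z * (N.AA o n o - N.AA o n z)
      = N.cTot v * N.AA o n o - N.cTot v * (N.AA o (n + 1) v - N.aa o 0 v) := by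
    rw [← sum_AA]
    unfold cTot
    rw [← tsum_mul_right, ← ((N.summ1 v).mul_right _).tsum_sub (N.summ v _)]
    exact tsum_congr fun z => by ring
  have h1 : N.c v z * (N.AA o n o - N.AA o n z) ≤
      ∑' z, N.c v z * (N.AA o n o - N.AA o n z) :=
    (N.summ v (fun z => N.AA o n o - N.AA o n z)).le_tsum z
      (fun j _ => mul_nonneg (N.nonneg _ _) (sub_nonneg.mpr (N.AA_le o n j)))
  have h2 : N.cTot v * N.aa o 0 v ≤ 1 := by
    rw [aa_zero]
    have := (N.cTot_pos v).ne'
    split_ifs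
    · field_simp
      exact le_refl _
    · simp
  have h3 : 0 ≤ N.cTot v * N.aa o n v := mul_nonneg (N.cTot_pos v).le (N.aa_nonneg o n v)
  rw [hs, AA_succ] at h1
  linarith

lemma D_bdd (o x : V) : ∃ C, ∀ n, N.AA o n o - N.AA o n x ≤ C := by
  induction N.conn o x with
  | refl => exact ⟨0, fun n => by simp⟩
  | @tail b d _ hbc ih =>
    obtain ⟨C, hC⟩ := ih
    refine ⟨(N.cTot b * C + 1) / N.c b d, fun n => ?_⟩
    rw [le_div_iff₀ hbc]
    have h1 := N.D_step o n b d
    have h2 := mul_le_mul_of_nonneg_left (hC n) (N.cTot_pos b).le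
    linarith

lemma E_step (o : V) (w : V → ℝ) (n : ℕ) :
    ∃ S : Finset V, (∀ v, v ∉ S → N.aa o n v = 0) ∧
    ∑' v, N.cTot v * N.aa o (n + 1) v * w v =
      ∑' v, N.cTot v * N.aa o n v * w v + ∑ z ∈ S, N.aa o n z * N.lap w z := by
  obtain ⟨S, hS⟩ := N.aa_fin o n
  refine ⟨S, hS, ?_⟩
  have h1 : ∑' v, N.cTot v * N.aa o n v * w v = ∑ v ∈ S, N.cTot v * N.aa o n v * w v :=
    tsum_eq_sum fun v hv => by rw [hS v hv]; ring
  have h2 : ∀ v, N.cTot v * N.aa o (n + 1) v * w v =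
      ∑ z ∈ S, N.c z v * w v * N.aa o n z := by
    intro v
    rw [aa_succ, tsum_eq_sum (s := S) (fun z hz => by rw [hS z hz]; ring), Finset.sum_mul]
    refine Finset.sum_congr rfl fun z _ => ?_
    rw [N.symm v z]
    ring
  simp_rw [h2]
  rw [Summable.tsum_finsetSum (fun z _ => (N.summ z w).mul_right _), h1,
    ← Finset.sum_add_distrib]
  refine Finset.sum_congr rfl fun z _ => ?_
  rw [tsum_mul_right, lap_eq]
  ring

lemma E_le (o x : V) (hox : o ≠ x) (w : V → ℝ) (hw : ∀ v, v ≠ o → N.lap w v ≤ 0) (n : ℕ) :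
    ∑' v, N.cTot v * N.aa o n v * w v ≤
      w o + N.AA o n o * N.lap w o + N.AA o n x * N.lap w x := by
  induction n with
  | zero =>
    rw [tsum_eq_single o]
    · have := (N.cTot_pos o).ne'
      simp [AA, aa_zero, this]
    · intro v hv
      rw [aa_zero, if_neg (Ne.symm hv)]
      ring
  | succ n ih =>
    obtain ⟨S, hS, h⟩ := N.E_step o w n
    have h1 : ∑ z ∈ S, N.aa o n z * N.lap w z ≤
        N.aa o n o * N.lap w o + N.aa o n x * N.lap w x := by
      have h2 : ∑ z ∈ S, N.aa o n z * N.lap w z =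
          ∑ z ∈ S ∪ {o, x}, N.aa o n z * N.lap w z :=
        Finset.sum_subset Finset.subset_union_left fun v _ hv => by rw [hS v hv, zero_mul]
      rw [h2, ← Finset.sum_pair hox (f := fun z => N.aa o n z * N.lap w z),
        ← Finset.sum_sdiff (Finset.subset_union_right : {o, x} ⊆ S ∪ {o, x})]
      have : ∑ z ∈ (S ∪ {o, x}) \ {o, x}, N.aa o n z * N.lap w z ≤ 0 := by
        refine Finset.sum_nonpos fun z hz => ?_
        have hz' : z ≠ o := by
          rintro rfl
          simp at hz
        exact mul_nonpos_of_nonneg_of_nonpos (N.aa_nonneg _ _ _) (hw z hz')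
      linarith
    rw [h, AA_succ, AA_succ]
    linarith

lemma AA_unbdd (hrec : N.Recurrent) (o : V) (B : ℝ) : ∃ n, B < N.AA o n o := by
  by_contra hB
  push Not at hB
  have h1 : Summable (fun n => N.aa o n o) :=
    summable_of_sum_range_le (fun n => N.aa_nonneg o n o) hB
  apply hrec o
  simp_rw [pstep_eq]
  exact h1.mul_left _

lemma lap_sum_nonneg (hrec : N.Recurrent) (o x : V) (hox : o ≠ x) (w : V → ℝ)
    (hw0 : ∀ v, 0 ≤ w v) (hwo : w o = 0)
    (hw : ∀ v, v ≠ o → N.lap w v ≤ 0) : 0 ≤ N.lap w o + N.lap w x := by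
  by_contra hneg
  push Not at hneg
  obtain ⟨C, hC⟩ := N.D_bdd o x
  have hx := hw x hox.symm
  obtain ⟨n, hn⟩ := N.AA_unbdd hrec o ((C * (- N.lap w x)) / (-(N.lap w o + N.lap w x)))
  rw [div_lt_iff₀ (by linarith)] at hn
  have h1 : 0 ≤ ∑' v, N.cTot v * N.aa o n v * w v :=
    tsum_nonneg fun v =>
      mul_nonneg (mul_nonneg (N.cTot_pos v).le (N.aa_nonneg _ _ _)) (hw0 v)
  have h2 := N.E_le o x hox w hw n
  have h3 := mul_le_mul_of_nonneg_right (hC n) (by linarith : 0 ≤ - N.lap w x)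
  nlinarith

lemma edge_aux (hrec : N.Recurrent) (o : V) (h : V → ℝ) (hpot : N.IsPotential o h)
    (x y : V) (hxy : 0 < N.c x y) (hlt : h y < h x) : h x - h y ≤ (N.c x y)⁻¹ := by
  obtain ⟨h0, ho, hlo, hl⟩ := hpot
  have hbpos : 0 < h x := lt_of_le_of_lt (h0 y) hlt
  have hox : o ≠ x := by
    rintro rfl
    linarith
  have hle : ∀ v, h v ≤ h x → N.lap (fun z => min (h z) (h x)) v ≤ N.lap h v := by
    intro v hv
    rw [lap, lap]
    refine (N.summ v _).tsum_le_tsum (fun z => ?_) (N.summ v _)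
    refine mul_le_mul_of_nonneg_left ?_ (N.nonneg _ _)
    have := min_le_left (h z) (h x)
    rw [min_eq_left hv]
    linarith
  have key := N.lap_sum_nonneg hrec o x hox (fun z => min (h z) (h x))
    (fun v => le_min (h0 v) (h0 x)) (by simp [ho, hbpos.le]) (by
      intro v hv
      by_cases hvx : h v ≤ h x
      · exact (hle v hvx).trans (hl v hv).le
      · refine tsum_nonpos fun z => mul_nonpos_of_nonneg_of_nonpos (N.nonneg _ _) ?_
        have := min_le_right (h z) (h x)
        simp only [min_eq_right (not_le.mp hvx).le]
        linarith)
  have h1 := hle o (by rw [ho]; exact hbpos.le)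
  rw [hlo] at h1
  have h2 : N.lap (fun z => min (h z) (h x)) x ≤ N.c x y * (h y - h x) := by
    have hs := N.summ x (fun z => -(min (h z) (h x) - min (h x) (h x)))
    have := hs.le_tsum y (fun z _ => by
      refine mul_nonneg (N.nonneg _ _) ?_
      have := min_le_right (h z) (h x)
      rw [min_self]
      linarith)
    simp only [mul_neg, tsum_neg] at this
    rw [lap]
    rw [min_eq_left hlt.le, min_self] at this
    simp only [min_self]
    linarith
  rw [← one_div, le_div_iff₀ hxy]
  linarith

end Network

/-- Every potential on a recurrent rooted network satisfies
`|h(x) − h(y)| ≤ 1/c_{xy}` across every edge. -/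
theorem potential_edge_lipschitz {V : Type*} (N : Network V) (hrec : N.Recurrent)
    (o : V) (h : V → ℝ) (hpot : N.IsPotential o h)
    (x y : V) (hxy : 0 < N.c x y) :
    |h x - h y| ≤ (N.c x y)⁻¹ := by
  rcases lt_trichotomy (h x) (h y) with hl | hl | hl
  · rw [abs_sub_comm, abs_of_pos (by linarith), N.symm x y]
    exact N.edge_aux hrec o h hpot y x (by rw [N.symm]; exact hxy) hl
  · rw [hl, sub_self, abs_zero]
    positivity
  · rw [abs_of_pos (by linarith)]
    exact N.edge_aux hrec o h hpot x y hxy hl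
end

section
/- Let h be a potential on a recurrent rooted network, {Y_n} the h-process with initial distribution μ_h(v)=c_{ov}h(v) for v∼o, and D a finite set containing o with μ_h(D)=1. Then for all x∈D, h(x) = E_{μ_h}[ g_o(x, Y_L) ], where L is the last exit time of {Y_n} from D. -/
open scoped Classical
open Filter Topology MeasureTheory ProbabilityTheory

namespace Network

variable {V : Type*} (N : Network V)

/-- The finite set of neighbours. -/
noncomputable def nbr (x : V) : Finset V := (N.locFin x).toFinset

lemma mem_nbr {x y : V} : y ∈ N.nbr x ↔ 0 < N.c x y := by simp [nbr]

lemma mem_nbr' {x y : V} : y ∈ N.nbr x ↔ 0 < N.c y x := by rw [mem_nbr, N.symm]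

lemma c_eq_zero {x y : V} (hy : y ∉ N.nbr x) : N.c x y = 0 := by
  rw [mem_nbr] at hy
  exact le_antisymm (not_lt.1 hy) (N.nonneg x y)

lemma cTot_eq (x : V) : N.cTot x = ∑ y ∈ N.nbr x, N.c x y :=
  tsum_eq_sum fun _ hb => N.c_eq_zero hb

lemma p_nonneg (x y : V) : 0 ≤ N.p x y := div_nonneg (N.nonneg x y) (N.cTot_pos x).le

lemma p_pos {x y : V} (hc : 0 < N.c x y) : 0 < N.p x y := div_pos hc (N.cTot_pos x)

lemma p_eq_zero {x y : V} (hy : y ∉ N.nbr x) : N.p x y = 0 := by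
  simp [p, N.c_eq_zero hy]

lemma p_eq_zero' {x y : V} (hy : x ∉ N.nbr y) : N.p x y = 0 := by
  apply N.p_eq_zero
  rw [mem_nbr'] at *
  rwa [N.symm]

lemma sum_p (x : V) : ∑ y ∈ N.nbr x, N.p x y = 1 := by
  unfold p
  rw [← Finset.sum_div, ← cTot_eq, div_self (N.cTot_pos x).ne']

lemma cTot_mul_p (x y : V) : N.cTot x * N.p x y = N.c x y := by
  unfold p
  field_simp [(N.cTot_pos x).ne']

lemma avoid_succ (A : Set V) (n : ℕ) (x y : V) (hy : y ∉ A) :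
    N.avoid A (n + 1) x y = ∑ z ∈ N.nbr y, N.avoid A n x z * N.p z y := by
  simp only [avoid, if_neg hy]
  exact tsum_eq_sum fun b hb => by rw [N.p_eq_zero' hb, mul_zero]

lemma avoid_mem (A : Set V) (n : ℕ) (x y : V) (hy : y ∈ A) : N.avoid A n x y = 0 := by
  cases n with
  | zero =>
    simp only [avoid]
    rw [if_neg]
    rintro ⟨rfl, h⟩
    exact h hy
  | succ n => simp [avoid, hy]

lemma avoid_mem_left (A : Set V) (n : ℕ) (x y : V) (hx : x ∈ A) : N.avoid A n x y = 0 := by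
  induction n generalizing y with
  | zero => simp [avoid, hx]
  | succ n ih => simp [avoid, ih]

lemma avoid_nonneg (A : Set V) (n : ℕ) (x y : V) : 0 ≤ N.avoid A n x y := by
  induction n generalizing y with
  | zero => simp only [avoid]; split_ifs <;> norm_num
  | succ n ih =>
    by_cases hy : y ∈ A
    · rw [avoid_mem _ _ _ _ _ hy]
    · rw [avoid_succ _ _ _ _ _ hy]
      exact Finset.sum_nonneg fun z _ => mul_nonneg (ih z) (N.p_nonneg _ _)

lemma avoid_front (A : Set V) (n : ℕ) (x y : V) (hx : x ∉ A) :
    N.avoid A (n + 1) x y = ∑ z ∈ N.nbr x, N.p x z * N.avoid A n z y := by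
  induction n generalizing y with
  | zero =>
    by_cases hy : y ∈ A
    · simp [avoid_mem _ _ _ _ _ hy]
    · rw [avoid_succ _ _ _ _ _ hy]
      have e1 : ∀ z, N.avoid A 0 x z * N.p z y = if z = x then N.p x y else 0 := by
        intro z
        simp only [avoid]
        by_cases hz : z = x
        · subst hz; simp [hx]
        · have : ¬ x = z := fun h => hz h.symm
          simp [hz, this]
      have e2 : ∀ z, N.p x z * N.avoid A 0 z y = if z = y then N.p x y else 0 := by
        intro z
        simp only [avoid]
        by_cases hz : z = y
        · subst hz; simp [hy]
        · simp [hz]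
      simp only [e1, e2, Finset.sum_ite_eq']
      have : x ∈ N.nbr y ↔ y ∈ N.nbr x := by rw [mem_nbr, mem_nbr']
      by_cases hxy : y ∈ N.nbr x
      · simp [this, hxy]
      · simp [this, hxy]
  | succ n ih =>
    by_cases hy : y ∈ A
    · simp [avoid_mem _ _ _ _ _ hy]
    · rw [avoid_succ _ _ _ _ _ hy]
      simp only [ih, avoid_succ N A n _ y hy, Finset.sum_mul, Finset.mul_sum]
      rw [Finset.sum_comm]
      exact Finset.sum_congr rfl fun z _ => Finset.sum_congr rfl fun w _ => by ring

lemma avoid_rev (A : Set V) (n : ℕ) (x y : V) :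
    N.cTot x * N.avoid A n x y = N.cTot y * N.avoid A n y x := by
  induction n generalizing x y with
  | zero =>
    by_cases hxy : x = y
    · subst hxy; rfl
    · have : ¬ y = x := fun h => hxy h.symm
      simp [avoid, hxy, this]
  | succ n ih =>
    by_cases hy : y ∈ A
    · simp [avoid_mem _ _ _ _ _ hy, avoid_mem_left _ _ _ _ _ hy]
    · rw [avoid_succ _ _ _ _ _ hy, avoid_front _ _ _ _ _ hy, Finset.mul_sum, Finset.mul_sum]
      refine Finset.sum_congr rfl fun z _ => ?_
      rw [← mul_assoc, ih, ← mul_assoc, N.cTot_mul_p, N.symm y z, ← N.cTot_mul_p z y]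
      ring

lemma pstep_eq_s9 (n : ℕ) (x y : V) : N.pstep n x y = N.avoid ∅ n x y := by
  induction n generalizing y with
  | zero => simp [avoid, pstep]
  | succ n ih => simp [avoid, pstep, ih]

/-- Nonnegative superharmonic functions on recurrent networks are harmonic. -/
lemma superharm (hrec : N.Recurrent) (u : V → ℝ) (hu : ∀ x, 0 ≤ u x)
    (hs : ∀ x, ∑ z ∈ N.nbr x, N.p x z * u z ≤ u x) (x : V) :
    ∑ z ∈ N.nbr x, N.p x z * u z = u x := by
  by_contra hne
  have hlt := lt_of_le_of_ne (hs x) hne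
  set φ := u x - ∑ z ∈ N.nbr x, N.p x z * u z with hφ
  have hφ0 : 0 < φ := by linarith
  have key : ∀ K y, (∑ n ∈ Finset.range K, N.pstep n y x) * φ ≤ u y := by
    intro K
    induction K with
    | zero => intro y; simpa using hu y
    | succ K ih =>
      intro y
      rw [Finset.sum_range_succ']
      have e : ∑ n ∈ Finset.range K, N.pstep (n + 1) y x
          = ∑ z ∈ N.nbr y, N.p y z * ∑ n ∈ Finset.range K, N.pstep n z x := by
        simp only [pstep_eq_s9, avoid_front N ∅ _ y x (by simp), Finset.mul_sum]
        rw [Finset.sum_comm]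
      rw [e, add_mul, Finset.sum_mul]
      have b : ∑ z ∈ N.nbr y, N.p y z * (∑ n ∈ Finset.range K, N.pstep n z x) * φ
          ≤ ∑ z ∈ N.nbr y, N.p y z * u z := by
        refine Finset.sum_le_sum fun z _ => ?_
        rw [mul_assoc]
        exact mul_le_mul_of_nonneg_left (ih z) (N.p_nonneg _ _)
      by_cases hyx : y = x
      · subst hyx
        simp only [pstep, if_true, one_mul]
        linarith
      · simp only [pstep, if_neg hyx, zero_mul]
        linarith [hs y]
  apply hrec x
  apply summable_of_sum_range_le (c := u x / φ)
  · intro n; rw [pstep_eq_s9]; exact N.avoid_nonneg _ _ _ _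
  · intro n; rw [le_div_iff₀ hφ0]; exact key n x

/-- probability of hitting `o` at time `n+1` from `y`. -/
noncomputable def hit (o y : V) (n : ℕ) : ℝ := ∑ v ∈ N.nbr o, N.avoid {o} n y v * N.p v o

lemma hit_nonneg (o y : V) (n : ℕ) : 0 ≤ N.hit o y n :=
  Finset.sum_nonneg fun z _ => mul_nonneg (N.avoid_nonneg _ _ _ _) (N.p_nonneg _ _)

lemma hit_zero (o y : V) (hy : y ≠ o) : N.hit o y 0 = N.p y o := by
  unfold hit
  have e1 : ∀ z, N.avoid {o} 0 y z * N.p z o = if z = y then N.p y o else 0 := by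
    intro z
    simp only [avoid]
    by_cases hz : z = y
    · subst hz; simp [hy]
    · have : ¬ y = z := fun h => hz h.symm
      simp [hz, this]
  simp only [e1, Finset.sum_ite_eq']
  split_ifs with h
  · rfl
  · exact (N.p_eq_zero' h).symm

lemma hit_succ (o y : V) (hy : y ≠ o) (n : ℕ) :
    N.hit o y (n + 1) = ∑ z ∈ N.nbr y, N.p y z * N.hit o z n := by
  unfold hit
  simp only [avoid_front N {o} n y _ (by simpa using hy), Finset.sum_mul, Finset.mul_sum]
  rw [Finset.sum_comm]
  exact Finset.sum_congr rfl fun z _ => Finset.sum_congr rfl fun w _ => by ring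

lemma hit_self (o : V) (n : ℕ) : N.hit o o n = 0 := by
  unfold hit
  simp [avoid_mem_left N {o} n o _ (by simp)]

/-- probability of having hit `o` by time `K`. -/
noncomputable def hitBy (o : V) (K : ℕ) (y : V) : ℝ :=
  (if y = o then 1 else 0) + ∑ n ∈ Finset.range K, N.hit o y n

lemma hitBy_succ (o y : V) (hy : y ≠ o) (K : ℕ) :
    N.hitBy o (K + 1) y = ∑ z ∈ N.nbr y, N.p y z * N.hitBy o K z := by
  unfold hitBy
  rw [Finset.sum_range_succ', hit_zero _ _ _ hy, if_neg hy]
  simp only [hit_succ _ _ _ hy, mul_add, Finset.sum_add_distrib, Finset.mul_sum]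
  rw [Finset.sum_comm]
  have : ∑ x ∈ N.nbr y, N.p y x * (if x = o then 1 else 0) = N.p y o := by
    simp only [mul_ite, mul_one, mul_zero, Finset.sum_ite_eq']
    split_ifs with h
    · rfl
    · exact (N.p_eq_zero h).symm
  rw [this]; ring

lemma hitBy_self (o : V) (K : ℕ) : N.hitBy o K o = 1 := by
  simp [hitBy, hit_self]

lemma hitBy_le (o : V) (K : ℕ) (y : V) : N.hitBy o K y ≤ 1 := by
  induction K generalizing y with
  | zero => unfold hitBy; split_ifs <;> norm_num
  | succ K ih =>
    by_cases hy : y = o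
    · subst hy; rw [hitBy_self]
    · rw [hitBy_succ _ _ _ hy, ← N.sum_p y]
      exact Finset.sum_le_sum fun z _ => mul_le_of_le_one_right (N.p_nonneg _ _) (ih z)

lemma summable_hit (o y : V) : Summable (N.hit o y) := by
  apply summable_of_sum_range_le (c := 1) (N.hit_nonneg o y)
  intro K
  have := N.hitBy_le o K y
  unfold hitBy at this
  split_ifs at this <;> linarith

lemma hasSum_hit (hrec : N.Recurrent) (o y : V) (hy : y ≠ o) : HasSum (N.hit o y) 1 := by
  set U : V → ℝ := fun y => (if y = o then 1 else 0) + ∑' n, N.hit o y n with hU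
  have hlim : ∀ y, Tendsto (fun K => N.hitBy o K y) atTop (𝓝 (U y)) := fun y =>
    (N.summable_hit o y).hasSum.tendsto_sum_nat.const_add _
  have hUo : U o = 1 := by simp [hU, hit_self]
  have hU0 : ∀ y, 0 ≤ U y := fun y => by
    have : 0 ≤ ∑' n, N.hit o y n := tsum_nonneg (N.hit_nonneg o y)
    simp only [hU]
    split_ifs <;> linarith
  have hU1 : ∀ y, U y ≤ 1 := fun y => le_of_tendsto' (hlim y) fun K => N.hitBy_le o K y
  have hh : ∀ y, y ≠ o → ∑ z ∈ N.nbr y, N.p y z * U z = U y := by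
    intro y hy
    have h1 := (hlim y).comp (tendsto_add_atTop_nat 1)
    have h2 : Tendsto (fun K => ∑ z ∈ N.nbr y, N.p y z * N.hitBy o K z) atTop
      (𝓝 (∑ z ∈ N.nbr y, N.p y z * U z)) :=
      tendsto_finsetSum _ fun z _ => (hlim z).const_mul _
    refine tendsto_nhds_unique h2 (h1.congr fun K => ?_)
    exact N.hitBy_succ o y hy K
  have hs : ∀ x, ∑ z ∈ N.nbr x, N.p x z * U z ≤ U x := by
    intro x
    by_cases hx : x = o
    · subst hx
      rw [hUo, ← N.sum_p x]
      exact Finset.sum_le_sum fun z _ => mul_le_of_le_one_right (N.p_nonneg _ _) (hU1 z)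
    · exact (hh x hx).le
  have hharm := N.superharm hrec U hU0 hs
  have hone : ∀ y, U y = 1 := by
    intro y
    induction N.conn o y with
    | refl => exact hUo
    | @tail a b _ hab ih =>
      have e : ∑ z ∈ N.nbr a, N.p a z * (1 - U z) = 0 := by
        simp only [mul_sub, mul_one, Finset.sum_sub_distrib, N.sum_p, hharm, ih, sub_self]
      rw [Finset.sum_eq_zero_iff_of_nonneg
        (fun z _ => mul_nonneg (N.p_nonneg _ _) (sub_nonneg.2 (hU1 z)))] at e
      have := e b (N.mem_nbr.2 hab)
      rcases mul_eq_zero.1 this with h | h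
      · exact absurd h (N.p_pos hab).ne'
      · linarith
  have := (N.summable_hit o y).hasSum
  have e := hone y
  simp only [hU, if_neg hy, zero_add] at e
  rwa [e] at this

/-- `A_n(y) = Σ_v c(o,v) avoid_n(v,y)`. -/
noncomputable def occ (o : V) (n : ℕ) (y : V) : ℝ := ∑ v ∈ N.nbr o, N.c o v * N.avoid {o} n v y

lemma occ_nonneg (o y : V) (n : ℕ) : 0 ≤ N.occ o n y :=
  Finset.sum_nonneg fun z _ => mul_nonneg (N.nonneg _ _) (N.avoid_nonneg _ _ _ _)

lemma occ_self (o : V) (n : ℕ) : N.occ o n o = 0 := by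
  unfold occ
  simp [avoid_mem N {o} n _ o (by simp)]

lemma occ_eq (o y : V) (n : ℕ) : N.occ o n y = N.cTot y * N.hit o y n := by
  unfold occ hit
  rw [Finset.mul_sum]
  refine Finset.sum_congr rfl fun v _ => ?_
  rw [← mul_assoc, ← N.avoid_rev, N.symm o v, ← N.cTot_mul_p v o]
  ring

lemma hasSum_occ (hrec : N.Recurrent) (o y : V) (hy : y ≠ o) :
    HasSum (fun n => N.occ o n y) (N.cTot y) := by
  have := (N.hasSum_hit hrec o y hy).mul_left (N.cTot y)
  simpa only [← occ_eq, mul_one] using this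

lemma summable_avoid (hrec : N.Recurrent) (o x y : V) :
    Summable (fun n => N.avoid {o} n x y) := by
  by_cases hy : y = o
  · subst hy
    simp only [avoid_mem N {y} _ _ y (by simp)]
    exact summable_zero
  induction N.conn o x with
  | refl =>
    simp only [avoid_mem_left N {o} _ o _ (by simp)]
    exact summable_zero
  | @tail a b _ hab ih =>
    by_cases ha : a = o
    · subst ha
      have h1 := (N.hasSum_occ hrec a y hy).summable
      have h2 : Summable fun n => N.c a b * N.avoid {a} n b y := by
        refine Summable.of_nonneg_of_le
          (fun n => mul_nonneg (N.nonneg _ _) (N.avoid_nonneg _ _ _ _)) (fun n => ?_) h1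
        exact Finset.single_le_sum (f := fun v => N.c a v * N.avoid {a} n v y)
          (fun z _ => mul_nonneg (N.nonneg _ _) (N.avoid_nonneg _ _ _ _)) (N.mem_nbr.2 hab)
      exact (summable_mul_left_iff hab.ne').1 h2
    · have h1 := (summable_nat_add_iff 1).2 ih
      have h2 : Summable fun n => N.p a b * N.avoid {o} n b y := by
        refine Summable.of_nonneg_of_le
          (fun n => mul_nonneg (N.p_nonneg _ _) (N.avoid_nonneg _ _ _ _)) (fun n => ?_) h1
        rw [avoid_front N {o} n a y (by simpa using ha)]
        exact Finset.single_le_sum (f := fun v => N.p a v * N.avoid {o} n v y)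
          (fun z _ => mul_nonneg (N.p_nonneg _ _) (N.avoid_nonneg _ _ _ _)) (N.mem_nbr.2 hab)
      exact (summable_mul_left_iff (N.p_pos hab).ne').1 h2

lemma countable_V {V : Type*} (N : Network V) (o : V) : Countable V := by
  let S : ℕ → Set V := fun n => Nat.rec {o} (fun _ T => ⋃ x ∈ T, {y | 0 < N.c x y}) n
  have hS : ∀ n, (S n).Countable := by
    intro n
    induction n with
    | zero => exact Set.countable_singleton o
    | succ n ih => exact ih.biUnion fun x _ => (N.locFin x).countable
  have hc : (⋃ n, S n).Countable := Set.countable_iUnion hS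
  have : (⋃ n, S n) = Set.univ := by
    ext y
    simp only [Set.mem_univ, iff_true]
    induction N.conn o y with
    | refl => exact Set.mem_iUnion.2 ⟨0, rfl⟩
    | @tail a b _ hab ih =>
      obtain ⟨n, hn⟩ := Set.mem_iUnion.1 ih
      exact Set.mem_iUnion.2 ⟨n + 1, Set.mem_biUnion hn hab⟩
  rw [this] at hc
  exact Set.countable_univ_iff.1 hc

/-- `esc D h M y = h(y) * P^h_y(no visit to D in times 1..M)`. -/
noncomputable def esc (D : Finset V) (h : V → ℝ) : ℕ → V → ℝ
  | 0, y => h y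
  | M + 1, y => ∑ z ∈ N.nbr y, if z ∈ D then 0 else N.p y z * esc D h M z

section pot
variable {o : V} {h : V → ℝ}

lemma IsPotential.harm (hpot : N.IsPotential o h) (x : V) (hx : x ≠ o) :
    ∑ z ∈ N.nbr x, N.p x z * h z = h x := by
  have h1 := hpot.2.2.2 x hx
  have h2 : N.lap h x = ∑ z ∈ N.nbr x, N.c x z * (h z - h x) :=
    tsum_eq_sum fun b hb => by rw [N.c_eq_zero hb, zero_mul]
  rw [h1] at h2
  simp only [← N.cTot_mul_p x, mul_assoc, ← Finset.mul_sum] at h2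
  have h3 := (mul_eq_zero.1 h2.symm).resolve_left (N.cTot_pos x).ne'
  simp only [mul_sub, Finset.sum_sub_distrib, ← Finset.sum_mul, N.sum_p] at h3
  linarith

lemma IsPotential.zero (hpot : N.IsPotential o h) (x y : V) (hx : x ≠ o) (h0 : h x = 0) :
    N.p x y * h y = 0 := by
  by_cases hy : y ∈ N.nbr x
  · have := hpot.harm N x hx
    rw [h0, Finset.sum_eq_zero_iff_of_nonneg
        (fun z _ => mul_nonneg (N.p_nonneg _ _) (hpot.1 z))] at this
    exact this y hy
  · rw [N.p_eq_zero hy, zero_mul]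

lemma esc_nonneg (hpot : N.IsPotential o h) (D : Finset V) (M : ℕ) (y : V) :
    0 ≤ N.esc D h M y := by
  induction M generalizing y with
  | zero => exact hpot.1 y
  | succ M ih =>
    refine Finset.sum_nonneg fun z _ => ?_
    split_ifs
    · exact le_rfl
    · exact mul_nonneg (N.p_nonneg _ _) (ih z)

lemma esc_succ_le (hpot : N.IsPotential o h) (D : Finset V) (hoD : o ∈ D) (M : ℕ) (y : V)
    (hy : y ≠ o) : N.esc D h (M + 1) y ≤ N.esc D h M y := by
  induction M generalizing y with
  | zero =>
    simp only [esc]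
    rw [← hpot.harm N y hy]
    refine Finset.sum_le_sum fun z _ => ?_
    split_ifs
    · exact mul_nonneg (N.p_nonneg _ _) (hpot.1 z)
    · exact le_rfl
  | succ M ih =>
    rw [esc, esc]
    refine Finset.sum_le_sum fun z _ => ?_
    split_ifs with hz
    · exact le_rfl
    · exact mul_le_mul_of_nonneg_left (ih z fun e => hz (e ▸ hoD)) (N.p_nonneg _ _)

lemma esc_antitone (hpot : N.IsPotential o h) (D : Finset V) (hoD : o ∈ D) (y : V)
    (hy : y ≠ o) : Antitone fun M => N.esc D h M y :=
  antitone_nat_of_succ_le fun M => esc_succ_le N hpot D hoD M y hy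

lemma esc_le (hpot : N.IsPotential o h) (D : Finset V) (hoD : o ∈ D) (M : ℕ) (y : V)
    (hy : y ≠ o) : N.esc D h M y ≤ h y :=
  esc_antitone N hpot D hoD y hy (Nat.zero_le M)

lemma exists_esc_lim (hpot : N.IsPotential o h) (D : Finset V) (hoD : o ∈ D) :
    ∃ E : V → ℝ, E o = 0 ∧
      ∀ y, y ≠ o → Tendsto (fun M => N.esc D h M y) atTop (𝓝 (E y)) := by
  refine ⟨fun y => if y = o then 0 else ⨅ M, N.esc D h M y, by simp, fun y hy => ?_⟩
  simp only [if_neg hy]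
  exact tendsto_atTop_ciInf (esc_antitone N hpot D hoD y hy)
    ⟨0, by rintro _ ⟨M, rfl⟩; exact esc_nonneg N hpot D M y⟩

lemma last_exit (hpot : N.IsPotential o h) (D : Finset V) (hoD : o ∈ D) (T : ℕ) (x : V) :
    (∑ n ∈ Finset.range (T + 1), ∑ y ∈ D, N.avoid {o} n x y * N.esc D h (T - n) y)
      + (if x ∈ D then 0 else N.esc D h T x) = h x := by
  have e0 : ∀ (x : V) (k : ℕ), x ≠ o → ∑ y ∈ D, N.avoid {o} 0 x y * N.esc D h k y
      = if x ∈ D then N.esc D h k x else 0 := by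
    intro x k hx
    have : ∀ y, N.avoid {o} 0 x y * N.esc D h k y = if x = y then N.esc D h k x else 0 := by
      intro y
      by_cases hxy : x = y
      · subst hxy; simp [avoid, hx]
      · simp [avoid, hxy]
    simp only [this, Finset.sum_ite_eq]
  by_cases hx : x = o
  · subst hx
    simp [avoid_mem_left N {x} _ x _ (by simp), hoD, hpot.2.1]
  induction T generalizing x with
  | zero =>
    rw [Finset.sum_range_one, e0 x _ hx]
    split_ifs <;> simp [esc]
  | succ T ih =>
    have ih' : ∀ x, (∑ n ∈ Finset.range (T + 1),
        ∑ y ∈ D, N.avoid {o} n x y * N.esc D h (T - n) y)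
      + (if x ∈ D then 0 else N.esc D h T x) = h x := by
      intro x
      by_cases hx : x = o
      · subst hx
        simp [avoid_mem_left N {x} _ x _ (by simp), hoD, hpot.2.1]
      · exact ih x hx
    rw [Finset.sum_range_succ', e0 x _ hx]
    have e1 : ∑ n ∈ Finset.range (T + 1),
        ∑ y ∈ D, N.avoid {o} (n + 1) x y * N.esc D h (T + 1 - (n + 1)) y
        = ∑ z ∈ N.nbr x, N.p x z * (∑ n ∈ Finset.range (T + 1),
            ∑ y ∈ D, N.avoid {o} n z y * N.esc D h (T - n) y) := by
      simp only [avoid_front N {o} _ x _ (by simpa using hx), Finset.mul_sum, Finset.sum_mul,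
        Nat.add_sub_add_right]
      rw [Finset.sum_comm]
      conv_rhs => rw [Finset.sum_comm]
      rw [Finset.sum_comm]
      refine Finset.sum_congr rfl fun n _ => ?_
      rw [Finset.sum_comm]
      exact Finset.sum_congr rfl fun z _ => Finset.sum_congr rfl fun w _ => by ring
    have e2 : ∑ z ∈ N.nbr x, N.p x z * (∑ n ∈ Finset.range (T + 1),
            ∑ y ∈ D, N.avoid {o} n z y * N.esc D h (T - n) y) + N.esc D h (T + 1) x = h x := by
      rw [← hpot.harm N x hx, esc, ← Finset.sum_add_distrib]
      refine Finset.sum_congr rfl fun z _ => ?_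
      rw [← ih' z, mul_add]
      split_ifs <;> simp
    rw [e1, Nat.sub_zero]
    split_ifs <;> linarith

lemma h_eq (hrec : N.Recurrent) (hpot : N.IsPotential o h) (D : Finset V) (hoD : o ∈ D)
    (E : V → ℝ) (hE : ∀ y, y ≠ o → Tendsto (fun M => N.esc D h M y) atTop (𝓝 (E y)))
    (x : V) (hx : x ∈ D) : ∑ y ∈ D, N.GreenK o x y * E y = h x := by
  have key : ∀ y ∈ D, Tendsto
      (fun T => ∑' n, if n < T + 1 then N.avoid {o} n x y * N.esc D h (T - n) y else 0) atTop
      (𝓝 (N.GreenK o x y * E y)) := by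
    intro y _
    by_cases hy : y = o
    · subst hy
      simp [GreenK, avoid_mem N {y} _ _ y (by simp)]
    · unfold GreenK
      rw [← tsum_mul_right]
      refine tendsto_tsum_of_dominated_convergence
        (bound := fun n => N.avoid {o} n x y * h y)
        ((N.summable_avoid hrec o x y).mul_right _) (fun n => ?_) (Eventually.of_forall ?_)
      · have h1 : Tendsto (fun T => N.avoid {o} n x y * N.esc D h (T - n) y) atTop
            (𝓝 (N.avoid {o} n x y * E y)) :=
          ((hE y hy).comp (tendsto_sub_atTop_nat n)).const_mul _
        refine h1.congr' ?_
        filter_upwards [eventually_ge_atTop n] with T hT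
        rw [if_pos (by omega)]
      · intro T n
        have a0 := N.avoid_nonneg {o} n x y
        split_ifs
        · rw [Real.norm_of_nonneg (mul_nonneg a0 (esc_nonneg N hpot D _ y))]
          exact mul_le_mul_of_nonneg_left (esc_le N hpot D hoD _ y hy) a0
        · rw [norm_zero]; exact mul_nonneg a0 (hpot.1 y)
  have k2 := tendsto_finsetSum D key
  refine tendsto_nhds_unique k2 (tendsto_const_nhds.congr fun T => ?_)
  have := last_exit N hpot D hoD T x
  rw [if_pos hx, add_zero] at this
  rw [← this, Finset.sum_comm]
  refine Finset.sum_congr rfl fun y _ => ?_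
  rw [tsum_eq_sum (s := Finset.range (T + 1))]
  · exact Finset.sum_congr rfl fun n hn => by rw [if_pos (Finset.mem_range.1 hn)]
  · intro n hn
    rw [if_neg (by simpa using hn)]

end pot
end Network

section chain
variable {V : Type*} [MeasurableSpace V]

lemma meas_cyl (hms : ∀ s : Set V, MeasurableSet s) (n : ℕ) (y : V) :
    MeasurableSet {ω : ℕ → V | ω n = y} :=
  measurableSet_preimage (measurable_pi_apply (X := fun _ : ℕ => V) n) (hms {y})

/-- Decompose over the value at time `n`. -/
lemma meas_split [Countable V] (hms : ∀ s : Set V, MeasurableSet s)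
    (P : Measure (ℕ → V)) (n : ℕ) (C : Set (ℕ → V)) (hC : MeasurableSet C) :
    P C = ∑' y, P (C ∩ {ω | ω n = y}) := by
  rw [← measure_iUnion]
  · congr 1
    ext ω
    simp
  · intro a b hab
    refine Set.disjoint_left.2 ?_
    rintro ω ⟨_, h1⟩ ⟨_, h2⟩
    exact hab (h1.symm.trans h2)
  · exact fun y => hC.inter (meas_cyl hms n y)

/-- Decompose over the path up to time `n`. -/
lemma meas_split_path [Countable V] (hms : ∀ s : Set V, MeasurableSet s)
    (P : Measure (ℕ → V)) (n : ℕ) (C : Set (ℕ → V)) (hC : MeasurableSet C) :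
    P C = ∑' s : Fin (n + 1) → V, P (C ∩ {ω | ∀ i : Fin (n + 1), ω i = s i}) := by
  rw [← measure_iUnion]
  · congr 1
    ext ω
    simp only [Set.mem_iUnion, Set.mem_inter_iff, Set.mem_ofPred_eq, exists_and_left]
    exact ⟨fun h => ⟨h, fun i => ω i, fun i => rfl⟩, fun h => h.1⟩
  · intro a b hab
    refine Set.disjoint_left.2 ?_
    rintro ω ⟨_, h1⟩ ⟨_, h2⟩
    exact hab (funext fun i => (h1 i).symm.trans (h2 i))
  · intro s
    refine hC.inter ?_
    rw [Set.ofPred_forall]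
    exact MeasurableSet.iInter fun i => meas_cyl hms _ _

/-- `B` depends only on the coordinates up to `n`. -/
def Past (n : ℕ) (B : Set (ℕ → V)) : Prop :=
  MeasurableSet B ∧ ∀ ω ω' : ℕ → V, (∀ i ≤ n, ω i = ω' i) → ω ∈ B → ω' ∈ B

lemma markov [Countable V] (hms : ∀ s : Set V, MeasurableSet s) {μ : V → ℝ} {q : V → V → ℝ}
    (hq : ∀ x y, 0 ≤ q x y) (P : Measure (ℕ → V)) (hP : IsChainLaw μ q P) (n : ℕ)
    (B : Set (ℕ → V)) (hB : Past n B) (y z : V) :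
    P (B ∩ {ω | ω n = y} ∩ {ω | ω (n + 1) = z})
      = P (B ∩ {ω | ω n = y}) * ENNReal.ofReal (q y z) := by
  have m1 : MeasurableSet (B ∩ {ω | ω n = y}) := hB.1.inter (meas_cyl hms _ _)
  rw [meas_split_path hms P n _ (m1.inter (meas_cyl hms _ _)), meas_split_path hms P n _ m1,
    ← ENNReal.tsum_mul_right]
  refine tsum_congr fun s => ?_
  set v : ℕ → V := fun i => if hi : i < n + 1 then s ⟨i, hi⟩ else z with hv
  have hv1 : ∀ i : Fin (n + 1), v i = s i := fun i => dif_pos i.2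
  have hcyl : {ω : ℕ → V | ∀ i : Fin (n + 1), ω i = s i} = {ω | ∀ i ≤ n, ω i = v i} := by
    ext ω
    constructor
    · intro h i hi
      have := h ⟨i, by omega⟩
      rw [← hv1] at this
      exact this
    · intro h i
      rw [← hv1]
      exact h i (by omega)
  by_cases hs : v ∈ B ∧ v n = y
  · have e1 : B ∩ {ω | ω n = y} ∩ {ω | ∀ i : Fin (n + 1), ω i = s i}
        = {ω | ∀ i ≤ n, ω i = v i} := by
      rw [hcyl]
      apply Set.inter_eq_right.2
      intro ω hω
      exact ⟨hB.2 v ω (fun i hi => (hω i hi).symm) hs.1, (hω n le_rfl).trans hs.2⟩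
    have e2 : B ∩ {ω | ω n = y} ∩ {ω | ω (n + 1) = z} ∩ {ω | ∀ i : Fin (n + 1), ω i = s i}
        = {ω | ∀ i ≤ n + 1, ω i = v i} := by
      rw [Set.inter_right_comm, e1]
      have hvz : v (n + 1) = z := by simp [hv]
      ext ω
      constructor
      · rintro ⟨h1, h2⟩ i hi
        rcases Nat.lt_or_ge n i with h | h
        · obtain rfl : i = n + 1 := by omega
          rw [hvz]; exact h2
        · exact h1 i h
      · intro h1
        exact ⟨fun i hi => h1 i (by omega), (h1 (n + 1) le_rfl).trans hvz⟩
    have hvz : v (n + 1) = z := by simp [hv]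
    rw [e1, e2, hP, hP, ← ENNReal.ofReal_mul' (hq _ _), Finset.prod_range_succ, hs.2, hvz,
      mul_assoc]
  · have e1 : B ∩ {ω | ω n = y} ∩ {ω | ∀ i : Fin (n + 1), ω i = s i} = ∅ := by
      rw [hcyl]
      apply Set.eq_empty_of_forall_notMem
      rintro ω ⟨⟨h1, h2⟩, h3⟩
      exact hs ⟨hB.2 ω v h3 h1, (h3 n le_rfl).symm.trans h2⟩
    rw [Set.inter_right_comm, e1]
    simp

/-- avoidance probabilities for the chain. -/
noncomputable def av (D : Finset V) (q : V → V → ℝ) : ℕ → V → ENNReal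
  | 0, _ => 1
  | M + 1, y => ∑' z, if z ∈ D then 0 else ENNReal.ofReal (q y z) * av D q M z

lemma meas_av (hms : ∀ s : Set V, MeasurableSet s) (D : Finset V) (n M : ℕ) :
    MeasurableSet {ω : ℕ → V | ∀ m, n < m → m ≤ n + M → ω m ∉ D} := by
  simp only [Set.ofPred_forall]
  exact MeasurableSet.iInter fun m => MeasurableSet.iInter fun _ => MeasurableSet.iInter fun _ =>
    measurableSet_preimage (measurable_pi_apply (X := fun _ : ℕ => V) m) (hms {y | y ∉ D})

lemma markov_av [Countable V] (hms : ∀ s : Set V, MeasurableSet s) {μ : V → ℝ} {q : V → V → ℝ}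
    (hq : ∀ x y, 0 ≤ q x y) (P : Measure (ℕ → V)) (hP : IsChainLaw μ q P) (D : Finset V)
    (M n : ℕ) (B : Set (ℕ → V)) (hB : Past n B) (y : V) :
    P (B ∩ {ω | ω n = y} ∩ {ω | ∀ m, n < m → m ≤ n + M → ω m ∉ D})
      = P (B ∩ {ω | ω n = y}) * av D q M y := by
  induction M generalizing n B y with
  | zero =>
    have : {ω : ℕ → V | ∀ m, n < m → m ≤ n + 0 → ω m ∉ D} = Set.univ := by
      ext ω; simp only [Set.mem_ofPred_eq, Set.mem_univ, iff_true]; intro m h1 h2; omega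
    rw [this, Set.inter_univ, av, mul_one]
  | succ M ih =>
    have m1 : MeasurableSet (B ∩ {ω | ω n = y}) := hB.1.inter (meas_cyl hms _ _)
    rw [meas_split hms P (n + 1) _ (m1.inter (meas_av hms D n (M + 1))), av,
      ← ENNReal.tsum_mul_left]
    refine tsum_congr fun z => ?_
    split_ifs with hz
    · rw [mul_zero]
      convert measure_empty (μ := P)
      apply Set.eq_empty_of_forall_notMem
      rintro ω ⟨⟨_, h2⟩, h3⟩
      apply h2 (n + 1) (by omega) (by omega)
      rw [Set.mem_ofPred_eq] at h3
      rwa [h3]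
    · have hB' : Past (n + 1) (B ∩ {ω | ω n = y}) := by
        refine ⟨m1, fun ω ω' h hω => ⟨hB.2 ω ω' (fun i hi => h i (by omega)) hω.1, ?_⟩⟩
        exact (h n (by omega)).symm.trans hω.2
      have := ih (n + 1) _ hB' z
      rw [markov hms hq P hP n B hB y z, mul_assoc] at this
      rw [← this]
      congr 1
      ext ω
      simp only [Set.mem_inter_iff, Set.mem_ofPred_eq]
      constructor
      · rintro ⟨⟨h1, h2⟩, h3⟩
        exact ⟨⟨h1, h3⟩, fun m a b => h2 m (by omega) (by omega)⟩
      · rintro ⟨⟨h1, h3⟩, h2⟩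
        refine ⟨⟨h1, fun m a b => ?_⟩, h3⟩
        rcases Nat.lt_or_ge (n + 1) m with h | h
        · exact h2 m h (by omega)
        · obtain rfl : m = n + 1 := by omega
          rwa [h3]

lemma past_univ (n : ℕ) : Past n (Set.univ : Set (ℕ → V)) :=
  ⟨MeasurableSet.univ, fun _ _ _ _ => trivial⟩

variable (N : Network V) {o : V} {h : V → ℝ}

lemma ph_nonneg (hpot : N.IsPotential o h) (x y : V) : 0 ≤ N.ph h x y :=
  div_nonneg (mul_nonneg (N.p_nonneg _ _) (hpot.1 y)) (hpot.1 x)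

lemma mul_ph (hpot : N.IsPotential o h) (x y : V) (hx : x ≠ o) :
    h x * N.ph h x y = N.p x y * h y := by
  unfold Network.ph
  by_cases h0 : h x = 0
  · rw [h0, hpot.zero N x y hx h0, zero_mul]
  · field_simp

lemma prob_at [Countable V] (hms : ∀ s : Set V, MeasurableSet s)
    (hpot : N.IsPotential o h) (P : Measure (ℕ → V))
    (hP : IsChainLaw (N.muh o h) (N.ph h) P) (n : ℕ) (y : V) :
    P {ω | ω n = y} = ENNReal.ofReal (N.occ o n y * h y) := by
  induction n generalizing y with
  | zero =>
    have := hP 0 (fun _ => y)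
    have e : {ω : ℕ → V | ∀ i ≤ 0, ω i = y} = {ω | ω 0 = y} := by
      ext ω; simp
    rw [e] at this
    rw [this, Finset.range_zero, Finset.prod_empty, mul_one, Network.muh]
    congr 1
    by_cases hy : y = o
    · subst hy; simp [hpot.2.1]
    · have : ∀ v, N.c o v * N.avoid {o} 0 v y = if v = y then N.c o y else 0 := by
        intro v
        by_cases hv : v = y
        · subst hv; simp [Network.avoid, hy]
        · simp [Network.avoid, hv]
      simp only [Network.occ, this, Finset.sum_ite_eq']
      split_ifs with hm
      · rfl
      · rw [N.c_eq_zero hm]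
  | succ n ih =>
    by_cases hy : y = o
    · subst hy
      rw [hpot.2.1, mul_zero, ENNReal.ofReal_zero, meas_split hms P n _ (meas_cyl hms _ _)]
      rw [ENNReal.tsum_eq_zero]
      intro z
      have := markov hms (ph_nonneg N hpot) P hP n _ (past_univ n) z y
      rw [Set.univ_inter, Set.inter_comm] at this
      rw [this, Network.ph, hpot.2.1]
      simp
    rw [meas_split hms P n _ (meas_cyl hms _ _)]
    have e : ∀ z, P ({ω | ω (n + 1) = y} ∩ {ω | ω n = z})
        = ENNReal.ofReal (N.occ o n z * N.p z y * h y) := by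
      intro z
      have := markov hms (ph_nonneg N hpot) P hP n _ (past_univ n) z y
      rw [Set.univ_inter, Set.inter_comm] at this
      rw [this, ih, ← ENNReal.ofReal_mul' (ph_nonneg N hpot z y)]
      congr 1
      by_cases hz : z = o
      · subst hz; simp [N.occ_self]
      · rw [mul_assoc, mul_ph N hpot z y hz, mul_assoc]
    simp only [e]
    rw [tsum_eq_sum (s := N.nbr y) (fun z hz => by simp [N.p_eq_zero' hz]),
      ← ENNReal.ofReal_sum_of_nonneg]
    · congr 1
      rw [← Finset.sum_mul]
      congr 1
      unfold Network.occ
      simp only [N.avoid_succ {o} n _ y (by simpa using hy), Finset.sum_mul, Finset.mul_sum]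
      rw [Finset.sum_comm]
      exact Finset.sum_congr rfl fun z _ => Finset.sum_congr rfl fun w _ => by ring
    · exact fun z _ => mul_nonneg (mul_nonneg (N.occ_nonneg _ _ _) (N.p_nonneg _ _)) (hpot.1 y)

lemma h_mul_av (hpot : N.IsPotential o h) (D : Finset V) (hoD : o ∈ D) (M : ℕ) (y : V)
    (hy : y ≠ o) : ENNReal.ofReal (h y) * av D (N.ph h) M y
      = ENNReal.ofReal (N.esc D h M y) := by
  induction M generalizing y with
  | zero => rw [av, mul_one, Network.esc]
  | succ M ih =>
    rw [av, ← ENNReal.tsum_mul_left, Network.esc, ENNReal.ofReal_sum_of_nonneg]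
    · rw [tsum_eq_sum (s := N.nbr y)]
      · refine Finset.sum_congr rfl fun z _ => ?_
        split_ifs with hz
        · simp
        · rw [ENNReal.ofReal_mul (N.p_nonneg _ _), ← ih z (fun e => hz (e ▸ hoD)), ← mul_assoc,
            ← mul_assoc, ← ENNReal.ofReal_mul (hpot.1 y), ← ENNReal.ofReal_mul (N.p_nonneg _ _),
            mul_ph N hpot y z hy]
      · intro z hz
        simp [Network.ph, N.p_eq_zero hz]
    · intro z _
      split_ifs
      · exact le_rfl
      · exact mul_nonneg (N.p_nonneg _ _) (Network.esc_nonneg N hpot D M z)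

lemma prob_last [Countable V] (hms : ∀ s : Set V, MeasurableSet s)
    (hpot : N.IsPotential o h) (D : Finset V) (hoD : o ∈ D) (P : Measure (ℕ → V))
    [IsProbabilityMeasure P]
    (hP : IsChainLaw (N.muh o h) (N.ph h) P) (E : V → ℝ)
    (hE : ∀ y, y ≠ o → Tendsto (fun M => N.esc D h M y) atTop (𝓝 (E y))) (n : ℕ) (y : V)
    (hy : y ≠ o) :
    P {ω | ω n = y ∧ ∀ m, n < m → ω m ∉ D} = ENNReal.ofReal (N.occ o n y * E y) := by
  set C : ℕ → Set (ℕ → V) := fun M =>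
    {ω | ω n = y} ∩ {ω | ∀ m, n < m → m ≤ n + M → ω m ∉ D} with hC
  have hC1 : ∀ M, P (C M) = ENNReal.ofReal (N.occ o n y * N.esc D h M y) := by
    intro M
    have := markov_av hms (ph_nonneg N hpot) P hP D M n _ (past_univ n) y
    rw [Set.univ_inter, prob_at N hms hpot P hP, ENNReal.ofReal_mul (N.occ_nonneg _ _ _),
      mul_assoc, h_mul_av N hpot D hoD M y hy, ← ENNReal.ofReal_mul (N.occ_nonneg _ _ _)] at this
    exact this
  have hi : {ω | ω n = y ∧ ∀ m, n < m → ω m ∉ D} = ⋂ M, C M := by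
    ext ω
    simp only [hC, Set.mem_iInter, Set.mem_inter_iff, Set.mem_ofPred_eq]
    constructor
    · rintro ⟨h1, h2⟩ M
      exact ⟨h1, fun m a _ => h2 m a⟩
    · intro H
      exact ⟨(H 0).1, fun m a => (H m).2 m a (by omega)⟩
  have t1 : Tendsto (fun M => P (C M)) atTop (𝓝 (P (⋂ M, C M))) := by
    refine tendsto_measure_iInter_atTop
      (fun M => ((meas_cyl hms _ _).inter (meas_av hms D n M)).nullMeasurableSet) ?_
      ⟨0, measure_ne_top _ _⟩
    intro a b hab ω hω
    exact ⟨hω.1, fun m h1 h2 => hω.2 m h1 (by omega)⟩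
  rw [hi]
  refine tendsto_nhds_unique t1 ?_
  simp only [hC1]
  exact ENNReal.tendsto_ofReal ((hE y hy).const_mul _)

lemma prob_exit [Countable V] (hms : ∀ s : Set V, MeasurableSet s) (hrec : N.Recurrent)
    (hpot : N.IsPotential o h) (D : Finset V) (hoD : o ∈ D) (P : Measure (ℕ → V))
    [IsProbabilityMeasure P]
    (hP : IsChainLaw (N.muh o h) (N.ph h) P) (E : V → ℝ) (hEo : E o = 0)
    (hE : ∀ y, y ≠ o → Tendsto (fun M => N.esc D h M y) atTop (𝓝 (E y))) (y : V) (hyD : y ∈ D) :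
    MeasurableSet {ω : ℕ → V | ∃ n, ω n = y ∧ ∀ m, n < m → ω m ∉ D} ∧
    P.real {ω | ∃ n, ω n = y ∧ ∀ m, n < m → ω m ∉ D} = N.cTot y * E y := by
  have hm : ∀ n, MeasurableSet {ω : ℕ → V | ω n = y ∧ ∀ m, n < m → ω m ∉ D} := by
    intro n
    refine (meas_cyl hms n y).inter (s₂ := {ω : ℕ → V | ∀ m, n < m → ω m ∉ D}) ?_
    simp only [Set.ofPred_forall]
    exact MeasurableSet.iInter fun m => MeasurableSet.iInter fun _ =>
      measurableSet_preimage (measurable_pi_apply (X := fun _ : ℕ => V) m) (hms {y | y ∉ D})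
  have he : {ω : ℕ → V | ∃ n, ω n = y ∧ ∀ m, n < m → ω m ∉ D}
      = ⋃ n, {ω | ω n = y ∧ ∀ m, n < m → ω m ∉ D} := by ext ω; simp
  rw [he]
  refine ⟨MeasurableSet.iUnion hm, ?_⟩
  rw [measureReal_def, measure_iUnion _ hm]
  · by_cases hy : y = o
    · have : ∀ n, P {ω | ω n = y ∧ ∀ m, n < m → ω m ∉ D} = 0 := by
        intro n
        refine measure_mono_null (t := {ω | ω n = y}) (fun ω hω => hω.1) ?_
        rw [prob_at N hms hpot P hP, hy, hpot.2.1]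
        simp
      rw [tsum_congr this]
      simp [hy, hEo]
    · have hE0 : 0 ≤ E y :=
        ge_of_tendsto' (hE y hy) fun M => Network.esc_nonneg N hpot D M y
      have hs := (N.hasSum_occ hrec o y hy).mul_right (E y)
      simp only [prob_last N hms hpot D hoD P hP E hE _ y hy]
      rw [← ENNReal.ofReal_tsum_of_nonneg (fun n => mul_nonneg (N.occ_nonneg _ _ _) hE0)
        hs.summable, hs.tsum_eq, ENNReal.toReal_ofReal (mul_nonneg (N.cTot_pos y).le hE0)]
  · intro a b hab
    refine Set.disjoint_left.2 ?_
    rintro ω ⟨h1, h2⟩ ⟨h3, h4⟩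
    rcases lt_or_gt_of_ne hab with h | h
    · exact h2 b h (h3 ▸ hyD)
    · exact h4 a h (h1 ▸ hyD)

lemma integrand_eq (D : Finset V) (f : V → ℝ) (ω : ℕ → V) :
    (if ({n | ω n ∈ D}).Nonempty ∧ BddAbove {n | ω n ∈ D}
            then f (ω (sSup {n | ω n ∈ D})) else 0)
    = ∑ y ∈ D, Set.indicator {ω : ℕ → V | ∃ n, ω n = y ∧ ∀ m, n < m → ω m ∉ D}
        (fun _ => f y) ω := by
  split_ifs with hc
  · have hL := Nat.sSup_mem hc.1 hc.2
    set L := sSup {n | ω n ∈ D} with hLdef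
    have hafter : ∀ m, L < m → ω m ∉ D := by
      intro m hm hmD
      exact absurd (le_csSup hc.2 hmD) (not_le.2 hm)
    rw [Finset.sum_eq_single (ω L)]
    · rw [Set.indicator_of_mem]
      exact ⟨L, rfl, hafter⟩
    · intro y hy hne
      rw [Set.indicator_of_notMem]
      rintro ⟨n, h1, h2⟩
      rcases lt_trichotomy n L with h | h | h
      · exact h2 L h hL
      · exact hne (by rw [← h1, h])
      · exact hafter n h (h1 ▸ hy)
    · intro hn
      exact absurd hL hn
  · symm
    refine Finset.sum_eq_zero fun y hy => ?_
    rw [Set.indicator_of_notMem]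
    rintro ⟨n, h1, h2⟩
    refine hc ⟨⟨n, by simpa [h1] using hy⟩, ⟨n, fun m hm => ?_⟩⟩
    by_contra hlt
    exact h2 m (not_le.1 hlt) hm

end chain

/-- Every potential restricted to a finite set `D` containing `o` with
`μ_h(D) = 1` is a mixture of dipoles: `h(x) = E_{μ_h}[ g_o(x, Y_L) ]`, where `L` is the
last exit time of the `h`-process from `D`. -/
theorem potential_is_mixture_of_dipoles {V : Type*} [MeasurableSpace V]
    (hms : ∀ s : Set V, MeasurableSet s)
    (N : Network V) (hrec : N.Recurrent) (o : V) (h : V → ℝ) (hpot : N.IsPotential o h)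
    (D : Finset V) (hoD : o ∈ D) (hsupp : ∀ v, 0 < N.muh o h v → v ∈ D)
    (P : MeasureTheory.Measure (ℕ → V)) [MeasureTheory.IsProbabilityMeasure P]
    (hchain : IsChainLaw (N.muh o h) (N.ph h) P) :
    ∀ x ∈ D, h x =
      ∫ ω, (if ({n | ω n ∈ D}).Nonempty ∧ BddAbove {n | ω n ∈ D}
            then N.g o x (ω (sSup {n | ω n ∈ D})) else 0) ∂P := by
  intro x hx
  have : Countable V := N.countable_V o
  obtain ⟨E, hEo, hE⟩ := Network.exists_esc_lim N hpot D hoD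
  have hpe := fun y hy => prob_exit N hms hrec hpot D hoD P hchain E hEo hE y hy
  simp only [integrand_eq D (N.g o x)]
  rw [integral_finsetSum]
  · rw [← Network.h_eq N hrec hpot D hoD E hE x hx]
    refine Finset.sum_congr rfl fun y hy => ?_
    rw [integral_indicator_const _ (hpe y hy).1, (hpe y hy).2, smul_eq_mul, Network.g]
    have := (N.cTot_pos y).ne'
    field_simp
  · intro y hy
    exact (integrable_const _).indicator (hpe y hy).1
end

section
/- For a transient Markov chain with Green kernel G and finitely supported initial distribution μ with G(μ,y)>0 for all y, and a finite set D containing x with μ(D)=1: E_μ[M(x, Y_L)] = 1, where M(x,y)=G(x,y)/G(μ,y) is the Martin kernel and L is the last visit time to D. -/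
open scoped Classical
open Filter Topology MeasureTheory ProbabilityTheory

/-- `n`-step transition probabilities of the Markov chain with one-step kernel `q`. -/
noncomputable def qstep {S : Type*} (q : S → S → ℝ) : ℕ → S → S → ℝ
  | 0, x, y => if x = y then 1 else 0
  | n + 1, x, y => ∑' z, qstep q n x z * q z y

/-- Green kernel `G(x,y) = Σ_n q^n(x,y)` of the chain. -/
noncomputable def GreenQ {S : Type*} (q : S → S → ℝ) (x y : S) : ℝ := ∑' n, qstep q n x y

section helpers

variable {S : Type*}

/-- ENNReal n-step kernel. -/
noncomputable def pE (q : S → S → ℝ) : ℕ → S → S → ENNReal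
  | 0, x, y => if x = y then 1 else 0
  | n + 1, x, y => ∑' z, pE q n x z * ENNReal.ofReal (q z y)

/-- Probability of avoiding `D` at times `1..N`. -/
noncomputable def eE (q : S → S → ℝ) (D : Finset S) : ℕ → S → ENNReal
  | 0, _ => 1
  | n + 1, y => ∑' z, ENNReal.ofReal (q y z) * (if z ∈ D then 0 else eE q D n z)

lemma sumQ (q : S → S → ℝ) (hq0 : ∀ x y, 0 ≤ q x y) (hq1 : ∀ x, (∑' y, q x y) = 1) (x : S) :
    ∑' y, ENNReal.ofReal (q x y) = 1 := by
  have hs : Summable (q x) := by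
    by_contra h
    have := hq1 x
    rw [tsum_eq_zero_of_not_summable h] at this
    norm_num at this
  rw [← ENNReal.ofReal_tsum_of_nonneg (hq0 x) hs, hq1]; simp

lemma sum_pE (q : S → S → ℝ) (hQ : ∀ x, ∑' y, ENNReal.ofReal (q x y) = 1) (n : ℕ) (x : S) :
    ∑' y, pE q n x y = 1 := by
  induction n with
  | zero => simp [pE]
  | succ n ih =>
    simp only [pE]
    rw [ENNReal.tsum_comm]
    simp [ENNReal.tsum_mul_left, hQ, ih]

lemma pE_le (q : S → S → ℝ) (hQ : ∀ x, ∑' y, ENNReal.ofReal (q x y) = 1) (n : ℕ) (x y : S) :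
    pE q n x y ≤ 1 := (ENNReal.le_tsum y).trans (sum_pE q hQ n x).le

lemma pE_ne (q : S → S → ℝ) (hQ : ∀ x, ∑' y, ENNReal.ofReal (q x y) = 1) (n : ℕ) (x y : S) :
    pE q n x y ≠ ⊤ := ((pE_le q hQ n x y).trans_lt ENNReal.one_lt_top).ne

lemma toReal_pE (q : S → S → ℝ) (hq0 : ∀ x y, 0 ≤ q x y)
    (hQ : ∀ x, ∑' y, ENNReal.ofReal (q x y) = 1) (n : ℕ) (x y : S) :
    (pE q n x y).toReal = qstep q n x y := by
  induction n generalizing y with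
  | zero => simp only [pE, qstep]; split_ifs <;> simp
  | succ n ih =>
    simp only [pE, qstep]
    rw [ENNReal.tsum_toReal_eq]
    · simp [ih, ENNReal.toReal_ofReal (hq0 _ _)]
    · intro z
      exact ENNReal.mul_ne_top (pE_ne q hQ n x z) ENNReal.ofReal_ne_top

lemma toReal_gE (q : S → S → ℝ) (hq0 : ∀ x y, 0 ≤ q x y)
    (hQ : ∀ x, ∑' y, ENNReal.ofReal (q x y) = 1) (x y : S) :
    (∑' n, pE q n x y).toReal = GreenQ q x y := by
  rw [ENNReal.tsum_toReal_eq (fun n => pE_ne q hQ n x y)]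
  simp [toReal_pE q hq0 hQ, GreenQ]

lemma gE_ne (q : S → S → ℝ) (hq0 : ∀ x y, 0 ≤ q x y)
    (hQ : ∀ x, ∑' y, ENNReal.ofReal (q x y) = 1)
    (htrans : ∀ x y : S, Summable fun n => qstep q n x y) (x y : S) :
    (∑' n, pE q n x y) ≠ ⊤ := by
  have h := (htrans x y).tsum_ofReal_ne_top
  convert h using 4 with n
  rw [← toReal_pE q hq0 hQ, ENNReal.ofReal_toReal (pE_ne q hQ n x y)]

lemma eE_anti (q : S → S → ℝ) (D : Finset S)
    (hQ : ∀ x, ∑' y, ENNReal.ofReal (q x y) = 1) (y : S) :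
    Antitone (fun N => eE q D N y) := by
  refine antitone_nat_of_succ_le ?_
  intro n
  induction n generalizing y with
  | zero =>
    simp only [eE]
    refine le_trans (ENNReal.tsum_le_tsum fun z => ?_) (hQ y).le
    split_ifs <;> simp
  | succ n ih =>
    rw [eE, eE]
    refine ENNReal.tsum_le_tsum fun z => ?_
    split_ifs
    · simp
    · gcongr; exact ih z

lemma eE_le (q : S → S → ℝ) (D : Finset S)
    (hQ : ∀ x, ∑' y, ENNReal.ofReal (q x y) = 1) (N : ℕ) (y : S) : eE q D N y ≤ 1 :=
  eE_anti q D hQ y (Nat.zero_le N)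

lemma b_step (q : S → S → ℝ) (D : Finset S) (x : S) (n N : ℕ) :
    ∑' z, pE q (n+1) x z * eE q D N z =
      ∑' z, pE q n x z * eE q D (N+1) z + ∑ y ∈ D, pE q (n+1) x y * eE q D N y := by
  have h1 : ∑' z, pE q n x z * eE q D (N+1) z
      = ∑' w, pE q (n+1) x w * (if w ∈ D then 0 else eE q D N w) := by
    simp only [eE, pE, ← ENNReal.tsum_mul_left, ← ENNReal.tsum_mul_right]
    rw [ENNReal.tsum_comm]
    simp only [mul_assoc]
  have h2 : ∑ y ∈ D, pE q (n+1) x y * eE q D N y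
      = ∑' w, pE q (n+1) x w * (if w ∈ D then eE q D N w else 0) := by
    rw [tsum_eq_sum (s := D)]
    · exact Finset.sum_congr rfl fun y hy => by simp [hy]
    · intro b hb; simp [hb]
  rw [h1, h2, ← ENNReal.tsum_add]
  refine tsum_congr fun w => ?_
  split_ifs <;> simp

lemma b_eq (q : S → S → ℝ) (D : Finset S) (x : S) (hx : x ∈ D) (n N : ℕ) :
    ∑' z, pE q n x z * eE q D N z =
      ∑ k ∈ Finset.range (n+1), ∑ y ∈ D, pE q k x y * eE q D (N+n-k) y := by
  induction n generalizing N with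
  | zero =>
    rw [tsum_eq_sum (s := D)]
    · simp
    · intro b hb
      have : x ≠ b := by rintro rfl; exact hb hx
      simp [pE, this]
  | succ n ih =>
    rw [b_step, ih, Finset.sum_range_succ _ (n+1)]
    congr 1
    · refine Finset.sum_congr rfl fun k _ => ?_
      rw [show N + 1 + n = N + (n+1) by ring]
    · simp

lemma last_exit (q : S → S → ℝ) (D : Finset S) (hq0 : ∀ x y, 0 ≤ q x y)
    (hQ : ∀ x, ∑' y, ENNReal.ofReal (q x y) = 1)
    (htrans : ∀ x y : S, Summable fun n => qstep q n x y) (x : S) (hx : x ∈ D) :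
    ∑ y ∈ D, (∑' n, pE q n x y) * (⨅ N, eE q D N y) = 1 := by
  have key : ∀ y, Tendsto (fun N => ∑' k, (if k ≤ N then pE q k x y * eE q D (N-k) y else 0))
      atTop (𝓝 (∑' k, pE q k x y * (⨅ N, eE q D N y))) := by
    intro y
    simp only [← lintegral_count]
    refine tendsto_lintegral_of_dominated_convergence (fun k => pE q k x y) ?_ ?_ ?_ ?_
    · intro n; exact measurable_from_top
    · intro n
      refine Eventually.of_forall fun k => ?_
      dsimp only
      split_ifs
      · exact mul_le_of_le_one_right' (eE_le q D hQ _ y)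
      · simp
    · rw [lintegral_count]; exact gE_ne q hq0 hQ htrans x y
    · refine Eventually.of_forall fun k => ?_
      have h1 : Tendsto (fun N => pE q k x y * eE q D (N-k) y) atTop
          (𝓝 (pE q k x y * (⨅ N, eE q D N y))) := by
        refine ENNReal.Tendsto.const_mul ?_ (Or.inr (pE_ne q hQ k x y))
        exact (tendsto_atTop_iInf (eE_anti q D hQ y)).comp (tendsto_sub_atTop_nat k)
      refine h1.congr' ?_
      filter_upwards [eventually_ge_atTop k] with N hN
      simp [hN]
  have h2 := tendsto_finsetSum D (fun y _ => key y)
  have h3 : (fun N => ∑ y ∈ D, ∑' k, (if k ≤ N then pE q k x y * eE q D (N-k) y else 0))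
      = fun _ => 1 := by
    funext N
    have h := b_eq q D x hx N 0
    simp only [eE, mul_one, sum_pE q hQ, Nat.zero_add] at h
    rw [h, Finset.sum_comm]
    refine Finset.sum_congr rfl fun y _ => ?_
    rw [tsum_eq_sum (s := Finset.range (N+1))]
    · refine Finset.sum_congr rfl fun k hk => ?_
      have : k ≤ N := by simpa [Nat.lt_succ_iff] using hk
      simp [this]
    · intro k hk
      have : ¬ k ≤ N := by simpa [Nat.lt_succ_iff] using hk
      simp [this]
  rw [h3] at h2
  simp only [ENNReal.tsum_mul_right] at h2
  exact tendsto_nhds_unique h2 tendsto_const_nhds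

variable [Countable S] [MeasurableSpace S] [DiscreteMeasurableSpace S]

lemma meas_coord (n : ℕ) (B : Set S) : MeasurableSet {ω : ℕ → S | ω n ∈ B} :=
  (measurable_pi_apply (X := fun _ : ℕ => S) n) (MeasurableSet.of_discrete (s := B))

lemma split_coord (P : Measure (ℕ → S)) (s : Set (ℕ → S)) (n : ℕ) :
    P s = ∑' z, P (s ∩ {ω | ω n = z}) := by
  have h := tsum_measure_preimage_singleton (μ := P.restrict s) (s := (Set.univ : Set S))
    (f := fun ω : ℕ → S => ω n) (Set.to_countable _)
    (fun y _ => measurable_pi_apply n (MeasurableSet.of_discrete))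
  rw [Set.preimage_univ, Measure.restrict_apply_univ, tsum_univ
    (fun z => (P.restrict s) ((fun ω : ℕ → S => ω n) ⁻¹' {z}))] at h
  rw [← h]
  refine tsum_congr fun z => ?_
  rw [Measure.restrict_apply (measurable_pi_apply n (MeasurableSet.of_discrete)), Set.inter_comm]
  rfl

lemma glue (P : Measure (ℕ → S)) (n : ℕ) (y : S) (T : Set (ℕ → S)) (c : ENNReal)
    (h : ∀ v : ℕ → S, v n = y → P ({ω | ∀ i ≤ n, ω i = v i} ∩ T) =
      P {ω | ∀ i ≤ n, ω i = v i} * c) :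
    P ({ω | ω n = y} ∩ T) = P {ω | ω n = y} * c := by
  let r : (ℕ → S) → (Fin (n+1) → S) := fun ω i => ω i
  have hr : Measurable r := by fun_prop
  let B : Set (Fin (n+1) → S) := {w | w (Fin.last n) = y}
  have hB : r ⁻¹' B = {ω | ω n = y} := by ext ω; simp [r, B]
  have hBm : MeasurableSet {ω : ℕ → S | ω n = y} :=
    meas_coord n {y}
  have hm : ∀ w ∈ B, MeasurableSet (r ⁻¹' {w}) := fun w _ => hr (MeasurableSet.of_discrete)
  have h1 := tsum_measure_preimage_singleton (μ := P.restrict T) (s := B) (f := r)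
    (Set.to_countable _) hm
  have h2 := tsum_measure_preimage_singleton (μ := P) (s := B) (f := r) (Set.to_countable _) hm
  rw [hB] at h1 h2
  rw [← Measure.restrict_apply hBm, ← h1, ← h2, ← ENNReal.tsum_mul_right]
  refine tsum_congr fun w => ?_
  rw [Measure.restrict_apply (hm w w.2)]
  let v : ℕ → S := fun i => if hi : i < n + 1 then w.1 ⟨i, hi⟩ else y
  have hv : r ⁻¹' {w.1} = {ω | ∀ i ≤ n, ω i = v i} := by
    ext ω
    simp only [r, Set.mem_preimage, Set.mem_singleton_iff, Set.mem_setOf_eq, funext_iff]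
    constructor
    · intro h i hi
      have := h ⟨i, by omega⟩
      simp only [v, Nat.lt_succ_iff.2 hi, dif_pos]
      exact this
    · intro h i
      have := h i (by omega)
      simpa [v, Nat.lt_succ_iff.1 i.2] using this
  rw [hv]
  refine h v ?_
  have := w.2
  simp only [B, Set.mem_setOf_eq] at this
  simp only [v, Nat.lt_succ_self, dif_pos]
  exact this

lemma cyl_succ (μ : S → ℝ) (q : S → S → ℝ) (hμ0 : ∀ x, 0 ≤ μ x) (hq0 : ∀ x y, 0 ≤ q x y)
    (P : Measure (ℕ → S)) (hchain : IsChainLaw μ q P) (n : ℕ) (v : ℕ → S) (z : S) :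
    P {ω | ∀ i ≤ n + 1, ω i = Function.update v (n+1) z i} =
      P {ω | ∀ i ≤ n, ω i = v i} * ENNReal.ofReal (q (v n) z) := by
  rw [hchain, hchain, ← ENNReal.ofReal_mul
    (mul_nonneg (hμ0 _) (Finset.prod_nonneg fun _ _ => hq0 _ _)), Finset.prod_range_succ]
  congr 1
  have h : ∏ i ∈ Finset.range n, q (Function.update v (n+1) z i) (Function.update v (n+1) z (i+1))
      = ∏ i ∈ Finset.range n, q (v i) (v (i+1)) := by
    refine Finset.prod_congr rfl fun i hi => ?_
    have := Finset.mem_range.1 hi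
    rw [Function.update_of_ne (by omega), Function.update_of_ne (by omega)]
  rw [h, Function.update_self, Function.update_of_ne (by omega), Function.update_of_ne (by omega)]
  ring

lemma cyl_inter (n : ℕ) (v : ℕ → S) (z : S) :
    {ω : ℕ → S | ∀ i ≤ n, ω i = v i} ∩ {ω | ω (n+1) = z}
      = {ω | ∀ i ≤ n + 1, ω i = Function.update v (n+1) z i} := by
  ext ω
  simp only [Set.mem_inter_iff, Set.mem_setOf_eq]
  constructor
  · rintro ⟨h1, h2⟩ i hi
    rcases Nat.lt_or_ge n i with h | h
    · obtain rfl : i = n + 1 := by omega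
      simp [h2]
    · rw [Function.update_of_ne (by omega)]; exact h1 i h
  · intro h
    refine ⟨fun i hi => ?_, by simpa using h (n+1) le_rfl⟩
    have := h i (by omega)
    rwa [Function.update_of_ne (by omega)] at this

lemma cyl_avoid (μ : S → ℝ) (q : S → S → ℝ) (hμ0 : ∀ x, 0 ≤ μ x) (hq0 : ∀ x y, 0 ≤ q x y)
    (P : Measure (ℕ → S)) (hchain : IsChainLaw μ q P) (D : Finset S) (N n : ℕ) (v : ℕ → S) :
    P ({ω | ∀ i ≤ n, ω i = v i} ∩ {ω | ∀ i, n < i → i ≤ n + N → ω i ∉ D}) =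
      P {ω | ∀ i ≤ n, ω i = v i} * eE q D N (v n) := by
  induction N generalizing n v with
  | zero =>
    have : {ω : ℕ → S | ∀ i, n < i → i ≤ n + 0 → ω i ∉ D} = Set.univ := by
      ext ω
      simp only [Set.mem_setOf_eq, Set.mem_univ, iff_true]
      intro i h1 h2; omega
    rw [this]; simp [eE]
  | succ N ih =>
    rw [split_coord P _ (n+1), eE, ← ENNReal.tsum_mul_left]
    refine tsum_congr fun z => ?_
    rw [Set.inter_right_comm, cyl_inter]
    by_cases hz : z ∈ D
    · simp only [hz, if_true, mul_zero]
      convert measure_empty (μ := P)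
      ext ω
      simp only [Set.mem_inter_iff, Set.mem_setOf_eq, Set.mem_empty_iff_false, iff_false, not_and]
      intro h1 h2
      refine h2 (n+1) (by omega) (by omega) ?_
      rw [h1 (n+1) le_rfl]; simpa using hz
    · have hset : {ω : ℕ → S | ∀ i ≤ n + 1, ω i = Function.update v (n+1) z i} ∩
          {ω | ∀ i, n < i → i ≤ n + (N+1) → ω i ∉ D} =
          {ω : ℕ → S | ∀ i ≤ n + 1, ω i = Function.update v (n+1) z i} ∩
          {ω | ∀ i, n + 1 < i → i ≤ (n + 1) + N → ω i ∉ D} := by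
        ext ω
        simp only [Set.mem_inter_iff, Set.mem_setOf_eq]
        refine and_congr_right fun h1 => ⟨fun h i a b => h i (by omega) (by omega), ?_⟩
        intro h i a b
        rcases Nat.lt_or_ge (n+1) i with hi | hi
        · exact h i hi (by omega)
        · obtain rfl : i = n + 1 := by omega
          rw [h1 (n+1) le_rfl]; simpa using hz
      rw [hset, ih, cyl_succ μ q hμ0 hq0 P hchain]
      simp [hz, mul_assoc]

lemma marg (μ : S → ℝ) (q : S → S → ℝ) (hμ0 : ∀ x, 0 ≤ μ x) (hq0 : ∀ x y, 0 ≤ q x y)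
    (P : Measure (ℕ → S)) (hchain : IsChainLaw μ q P) (n : ℕ) (y : S) :
    P {ω | ω n = y} = ∑' z, ENNReal.ofReal (μ z) * pE q n z y := by
  induction n generalizing y with
  | zero =>
    have h := hchain 0 (fun _ => y)
    simp only [Nat.le_zero, forall_eq, Finset.range_zero, Finset.prod_empty, mul_one] at h
    rw [h, tsum_eq_single y]
    · simp [pE]
    · intro b hb; simp [pE, hb]
  | succ n ih =>
    rw [split_coord P _ n]
    simp only [pE, ← ENNReal.tsum_mul_left]
    rw [ENNReal.tsum_comm]
    refine tsum_congr fun w => ?_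
    rw [Set.inter_comm, glue P n w _ (ENNReal.ofReal (q w y)), ih, ← ENNReal.tsum_mul_right]
    · simp only [mul_assoc]
    · rintro v rfl
      rw [cyl_inter, cyl_succ μ q hμ0 hq0 P hchain]

/-- last visit to `D` is at time `n`, at `y`. -/
def lastAt (D : Finset S) (n : ℕ) (y : S) : Set (ℕ → S) :=
  {ω | ω n = y} ∩ {ω | ∀ i, n < i → ω i ∉ D}

lemma meas_avoid (D : Finset S) (p : ℕ → Prop) :
    MeasurableSet {ω : ℕ → S | ∀ i, p i → ω i ∉ D} := by
  simp only [Set.setOf_forall]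
  refine MeasurableSet.iInter fun i => MeasurableSet.iInter fun _ => ?_
  exact meas_coord i {s | s ∉ D}

lemma meas_lastAt (D : Finset S) (n : ℕ) (y : S) : MeasurableSet (lastAt D n y) :=
  (meas_coord n {y}).inter (meas_avoid D _)

lemma P_lastAt (μ : S → ℝ) (q : S → S → ℝ) (hμ0 : ∀ x, 0 ≤ μ x) (hq0 : ∀ x y, 0 ≤ q x y)
    (hQ : ∀ x, ∑' y, ENNReal.ofReal (q x y) = 1)
    (P : Measure (ℕ → S)) [IsProbabilityMeasure P]
    (hchain : IsChainLaw μ q P) (D : Finset S) (n : ℕ) (y : S) :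
    P (lastAt D n y) = P {ω | ω n = y} * ⨅ N, eE q D N y := by
  let A : ℕ → Set (ℕ → S) := fun N => {ω | ω n = y} ∩ {ω | ∀ i, n < i → i ≤ n + N → ω i ∉ D}
  have hA : ∀ N, P (A N) = P {ω | ω n = y} * eE q D N y := by
    intro N
    refine glue P n y _ _ ?_
    rintro v rfl
    exact cyl_avoid μ q hμ0 hq0 P hchain D N n v
  have hI : lastAt D n y = ⋂ N, A N := by
    ext ω
    simp only [lastAt, A, Set.mem_iInter, Set.mem_inter_iff, Set.mem_setOf_eq]
    constructor
    · rintro ⟨h1, h2⟩ N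
      exact ⟨h1, fun i hi _ => h2 i hi⟩
    · intro h
      exact ⟨(h 0).1, fun i hi => (h i).2 i hi (by omega)⟩
  have hanti : Antitone A := by
    intro a b hab ω h
    exact ⟨h.1, fun i h1 h2 => h.2 i h1 (by omega)⟩
  have hAm : ∀ N, NullMeasurableSet (A N) P := by
    intro N
    refine MeasurableSet.nullMeasurableSet ?_
    refine (meas_coord n {y}).inter ?_
    simpa only [and_imp] using meas_avoid D (fun i => n < i ∧ i ≤ n + N)
  have h1 := tendsto_measure_iInter_atTop hAm hanti ⟨0, measure_ne_top P _⟩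
  rw [← hI] at h1
  have h2 : Tendsto (fun N => P {ω | ω n = y} * eE q D N y) atTop
      (𝓝 (P {ω | ω n = y} * ⨅ N, eE q D N y)) :=
    ENNReal.Tendsto.const_mul (tendsto_atTop_iInf (eE_anti q D hQ y))
      (Or.inr (measure_ne_top P _))
  refine tendsto_nhds_unique h1 (h2.congr fun N => (hA N).symm)

lemma pointwise_sum (D : Finset S) (m : S → ℝ) (ω : ℕ → S) :
    ∑ y ∈ D, ∑' n, (lastAt D n y).indicator (fun _ => ENNReal.ofReal (m y)) ω =
      ENNReal.ofReal (if ({n | ω n ∈ D}).Nonempty ∧ BddAbove {n | ω n ∈ D}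
          then m (ω (sSup {n | ω n ∈ D})) else 0) := by
  split_ifs with h
  · obtain ⟨hne, hb⟩ := h
    set L := sSup {n | ω n ∈ D} with hL
    have hLD : ω L ∈ D := Nat.sSup_mem hne hb
    have hmax : ∀ i, ω i ∈ D → i ≤ L := fun i hi => le_csSup hb hi
    rw [Finset.sum_eq_single_of_mem _ hLD, tsum_eq_single L]
    · rw [Set.indicator_of_mem]
      refine ⟨rfl, fun i hi hiD => ?_⟩
      have := hmax i hiD
      omega
    · intro n hn
      refine Set.indicator_of_notMem ?_ _
      rintro ⟨h1, h2⟩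
      have h1' : ω n = ω L := h1
      have hnD : n ≤ L := hmax n (by rw [h1']; exact hLD)
      exact h2 L (by omega) hLD
    · intro y hy hyne
      rw [ENNReal.tsum_eq_zero]
      intro n
      refine Set.indicator_of_notMem ?_ _
      rintro ⟨h1, h2⟩
      have h1' : ω n = y := h1
      have hnD : n ≤ L := hmax n (by rw [h1']; exact hy)
      rcases hnD.lt_or_eq with hlt | heq
      · exact h2 L hlt hLD
      · exact hyne (by rw [← h1', heq])
  · simp only [ENNReal.ofReal_zero]
    refine Finset.sum_eq_zero fun y hy => ?_
    rw [ENNReal.tsum_eq_zero]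
    intro n
    refine Set.indicator_of_notMem ?_ _
    rintro ⟨h1, h2⟩
    have h1' : ω n = y := h1
    refine h ⟨⟨n, by simpa [h1'] using hy⟩, ⟨n, fun i hi => ?_⟩⟩
    by_contra hcon
    exact h2 i (by omega) hi

end helpers

/-- For a transient Markov chain started from a finitely supported `μ` with
`G(μ,y) > 0` for all `y`, and a finite set `D ∋ x` with `μ(D) = 1`:
`E_μ[M(x, Y_L)] = 1`, where `M(x,y) = G(x,y)/G(μ,y)` is the Martin kernel and `L` the
last visit time to `D` (the term being `0` if the chain never visits `D`). -/
theorem martin_kernel_last_exit_expectation {S : Type*} [Countable S] [MeasurableSpace S]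
    (hms : ∀ s : Set S, MeasurableSet s)
    (q : S → S → ℝ) (hq0 : ∀ x y, 0 ≤ q x y) (hq1 : ∀ x, (∑' y, q x y) = 1)
    (htrans : ∀ x y : S, Summable fun n => qstep q n x y)
    (μ : S → ℝ) (hμ0 : ∀ x, 0 ≤ μ x) (hμ1 : (∑' x, μ x) = 1)
    (hμfin : (Function.support μ).Finite)
    (hGμ : ∀ y : S, 0 < ∑' z, μ z * GreenQ q z y)
    (x : S) (D : Finset S) (hx : x ∈ D) (hμD : ∀ v, 0 < μ v → v ∈ D)
    (P : MeasureTheory.Measure (ℕ → S)) [MeasureTheory.IsProbabilityMeasure P]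
    (hchain : IsChainLaw μ q P) :
    ∫ ω, (if ({n | ω n ∈ D}).Nonempty ∧ BddAbove {n | ω n ∈ D}
          then GreenQ q x (ω (sSup {n | ω n ∈ D})) /
                ∑' z, μ z * GreenQ q z (ω (sSup {n | ω n ∈ D}))
          else 0) ∂P = 1 := by
  haveI : DiscreteMeasurableSpace S := ⟨hms⟩
  have hQ := sumQ q hq0 hq1
  let gm : S → ENNReal := fun y => ∑' z, ENNReal.ofReal (μ z) * ∑' n, pE q n z y
  have hgm : ∀ y, (gm y).toReal = ∑' z, μ z * GreenQ q z y := by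
    intro y
    rw [ENNReal.tsum_toReal_eq]
    · simp [toReal_gE q hq0 hQ, ENNReal.toReal_ofReal (hμ0 _)]
    · intro z
      exact ENNReal.mul_ne_top ENNReal.ofReal_ne_top (gE_ne q hq0 hQ htrans z y)
  have hgpos : ∀ y, 0 < (gm y).toReal := fun y => by rw [hgm]; exact hGμ y
  have hg0 : ∀ y, gm y ≠ 0 := fun y h => by have := hgpos y; simp [h] at this
  have hgt : ∀ y, gm y ≠ ⊤ := fun y h => by have := hgpos y; simp [h] at this
  let m : S → ℝ := fun y => GreenQ q x y / ∑' z, μ z * GreenQ q z y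
  have hm0 : ∀ y, 0 ≤ m y := fun y => by
    refine div_nonneg ?_ (hGμ y).le
    rw [← toReal_gE q hq0 hQ]; exact ENNReal.toReal_nonneg
  have hmE : ∀ y, ENNReal.ofReal (m y) * gm y = ∑' n, pE q n x y := by
    intro y
    rw [show m y = (∑' n, pE q n x y).toReal / (gm y).toReal by
      rw [toReal_gE q hq0 hQ, hgm], ← ENNReal.toReal_div, ENNReal.ofReal_toReal]
    · exact ENNReal.div_mul_cancel (hg0 y) (hgt y)
    · exact ENNReal.div_ne_top (gE_ne q hq0 hQ htrans x y) (hg0 y)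
  let F : (ℕ → S) → ENNReal := fun ω =>
    ∑ y ∈ D, ∑' n, (lastAt D n y).indicator (fun _ => ENNReal.ofReal (m y)) ω
  have hind : ∀ y n, Measurable ((lastAt D n y).indicator
      (fun _ : ℕ → S => ENNReal.ofReal (m y))) :=
    fun y n => measurable_const.indicator (meas_lastAt D n y)
  have hFm : Measurable F :=
    Finset.measurable_fun_sum D fun y _ => Measurable.ennreal_tsum fun n => hind y n
  have hF : ∫⁻ ω, F ω ∂P = 1 := by
    rw [← last_exit q D hq0 hQ htrans x hx]
    simp only [F]
    rw [lintegral_finsetSum D fun y _ => Measurable.ennreal_tsum fun n => hind y n]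
    refine Finset.sum_congr rfl fun y _ => ?_
    rw [lintegral_tsum fun n => (hind y n).aemeasurable, ← hmE]
    simp only [lintegral_indicator_const (meas_lastAt D _ y),
      P_lastAt μ q hμ0 hq0 hQ P hchain, marg μ q hμ0 hq0 P hchain]
    rw [ENNReal.tsum_mul_left, ENNReal.tsum_mul_right, ENNReal.tsum_comm]
    simp only [ENNReal.tsum_mul_left, gm, mul_assoc]
  have hFt : ∀ ω, F ω = ENNReal.ofReal (if ({n | ω n ∈ D}).Nonempty ∧ BddAbove {n | ω n ∈ D}
          then m (ω (sSup {n | ω n ∈ D})) else 0) := fun ω => pointwise_sum D m ω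
  have heq : ∀ ω : ℕ → S, (if ({n | ω n ∈ D}).Nonempty ∧ BddAbove {n | ω n ∈ D}
          then m (ω (sSup {n | ω n ∈ D})) else 0) = (F ω).toReal := by
    intro ω
    rw [hFt, ENNReal.toReal_ofReal]
    split_ifs
    · exact hm0 _
    · exact le_rfl
  calc _ = ∫ ω, (F ω).toReal ∂P := integral_congr_ae (Eventually.of_forall heq)
    _ = (∫⁻ ω, F ω ∂P).toReal := integral_toReal hFm.aemeasurable
        (Eventually.of_forall fun ω => by rw [hFt]; exact ENNReal.ofReal_lt_top)
    _ = 1 := by rw [hF]; simp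
end
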